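/- arXiv:1205.1067 — 2 statements merged into one kernel-verified Lean document; each statement's English description precedes it below -/
import Mathlib

section
/- (Boole–Letac) Let β ∈ ℝ and let ρ be a finite positive Borel measure on ℝ which is singular with respect to Lebesgue measure, and define f(z) = z + β + ∫_ℝ (1+zt)/(t−z) dρ(t) for z ∈ ℂ⁺. Then for Lebesgue-almost every x ∈ ℝ the boundary value f(x) = lim_{ε↓0} f(x+iε) exists and is real, and the map f preserves Lebesgue measure on the boundary: for all real c < d, the Lebesgue measure of {x ∈ ℝ : f(x) ∈ (c,d)} equals d − c. -/
open Complex MeasureTheory Set Filter Topology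

lemma isOpen_upperHalf : IsOpen {z : ℂ | 0 < z.im} := isOpen_lt continuous_const continuous_im

lemma upperHalf_mem_nhds {z : ℂ} (hz : 0 < z.im) : {z : ℂ | 0 < z.im} ∈ 𝓝 z :=
  isOpen_upperHalf.mem_nhds hz

lemma closedUpperHalf_mem_nhds {z : ℂ} (hz : 0 < z.im) : {z : ℂ | 0 ≤ z.im} ∈ 𝓝 z :=
  mem_of_superset (upperHalf_mem_nhds hz) fun _ h => le_of_lt (mem_ofPred.1 h)

/-- A function holomorphic in the upper half-plane, continuous up to the real line and decaying
quadratically has vanishing integral over the real line. -/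
lemma integral_real_line_eq_zero {q : ℂ → ℂ} {C R₀ : ℝ}
    (hc : ContinuousOn q {z | 0 ≤ z.im}) (hd : DifferentiableOn ℂ q {z | 0 < z.im})
    (hi : Integrable (fun t : ℝ => q t))
    (hb : ∀ z : ℂ, 0 ≤ z.im → R₀ ≤ ‖z‖ → ‖q z‖ * ‖z‖ ^ 2 ≤ C) :
    ∫ t : ℝ, q t = 0 := by
  have h1 : Tendsto (fun R : ℝ => ∫ t in (-R)..R, q t) atTop (𝓝 (∫ t : ℝ, q t)) :=
    intervalIntegral_tendsto_integral hi tendsto_neg_atTop_atBot tendsto_id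
  refine tendsto_nhds_unique h1 ?_
  have h2 : Tendsto (fun R : ℝ => 4 * C / R) atTop (𝓝 0) :=
    tendsto_const_nhds.div_atTop tendsto_id
  refine squeeze_zero_norm' ?_ h2
  filter_upwards [eventually_ge_atTop R₀, eventually_gt_atTop 0] with R hR hR0
  have hbd : ∀ z : ℂ, 0 ≤ z.im → R ≤ ‖z‖ → ‖q z‖ ≤ C / R ^ 2 := by
    intro z hz hzR
    rw [le_div_iff₀ (by positivity)]
    refine le_trans ?_ (hb z hz (hR.trans hzR))
    gcongr
  have key := Complex.integral_boundary_rect_eq_zero_of_continuousOn_of_differentiableOn q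
    (⟨-R, 0⟩ : ℂ) (⟨R, R⟩ : ℂ) (hc.mono ?_) (hd.mono ?_)
  · simp only [ofReal_zero, zero_mul, add_zero] at key
    have e1 : ‖∫ x : ℝ in (-R)..R, q (x + R * I)‖ ≤ C / R ^ 2 * |R - -R| := by
      refine intervalIntegral.norm_integral_le_of_norm_le_const fun x _ => hbd _ (by simp [hR0.le]) ?_
      simpa [abs_of_pos hR0] using abs_im_le_norm (x + R * I : ℂ)
    have e2 : ‖∫ y : ℝ in (0:ℝ)..R, q (R + y * I)‖ ≤ C / R ^ 2 * |R - 0| := by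
      refine intervalIntegral.norm_integral_le_of_norm_le_const fun y hy => hbd _ ?_ ?_
      · rw [uIoc_of_le hR0.le] at hy
        simpa using hy.1.le
      simpa [abs_of_pos hR0] using abs_re_le_norm (R + y * I : ℂ)
    have e3 : ‖∫ y : ℝ in (0:ℝ)..R, q ((-R : ℝ) + y * I)‖ ≤ C / R ^ 2 * |R - 0| := by
      refine intervalIntegral.norm_integral_le_of_norm_le_const fun y hy => hbd _ ?_ ?_
      · rw [uIoc_of_le hR0.le] at hy
        simpa using hy.1.le
      simpa [abs_of_pos hR0] using abs_re_le_norm ((-R : ℝ) + y * I : ℂ)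
    rw [show |R - -R| = 2 * R by rw [abs_of_pos] <;> linarith] at e1
    rw [sub_zero, abs_of_pos hR0] at e2 e3
    have e4 : ∫ x : ℝ in (-R)..R, q x = (∫ x : ℝ in (-R)..R, q (x + R * I))
        - I • (∫ y : ℝ in (0:ℝ)..R, q (R + y * I))
        + I • (∫ y : ℝ in (0:ℝ)..R, q ((-R : ℝ) + y * I)) := by
      linear_combination key
    rw [e4]
    calc _ ≤ C / R ^ 2 * (2 * R) + C / R ^ 2 * R + C / R ^ 2 * R := by
          refine (norm_add_le _ _).trans (add_le_add ((norm_sub_le _ _).trans (add_le_add e1 ?_)) ?_)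
          · simpa [norm_smul] using e2
          · simpa [norm_smul] using e3
      _ = 4 * C / R := by field_simp; ring
  · intro z hz
    have := hz.2
    simp only [uIcc_of_le hR0.le] at this
    exact this.1
  · intro z hz
    have := hz.2
    simp only [min_eq_left hR0.le] at this
    exact this.1

lemma integrable_div_one_add_sq {h : ℝ → ℂ} {M : ℝ} (hc : Continuous h) (hb : ∀ t, ‖h t‖ ≤ M) :
    Integrable (fun t : ℝ => h t / (1 + (t : ℂ) ^ 2)) := by
  have h1 : Integrable (fun t : ℝ => M * (1 + t ^ 2)⁻¹) := integrable_inv_one_add_sq.const_mul M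
  have h0 : ∀ t : ℝ, (1 + (t : ℂ) ^ 2) ≠ 0 := by
    intro t
    norm_cast
    positivity
  refine h1.mono' ((hc.div (by fun_prop) h0).aestronglyMeasurable) (.of_forall fun t => ?_)
  rw [norm_div, div_eq_mul_inv, show (1 + (t : ℂ) ^ 2) = ((1 + t ^ 2 : ℝ) : ℂ) by push_cast; ring,
    norm_real, Real.norm_of_nonneg (by positivity : (0:ℝ) ≤ 1 + t ^ 2)]
  gcongr
  exact hb t

lemma half_norm_le_norm_sub_I {w : ℂ} (hw : 2 ≤ ‖w‖) : ‖w‖ / 2 ≤ ‖w - I‖ := by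
  have := norm_sub_norm_le w I
  rw [norm_I] at this
  linarith

lemma half_norm_le_norm_add_I {w : ℂ} (hw : 2 ≤ ‖w‖) : ‖w‖ / 2 ≤ ‖w + I‖ := by
  have := norm_sub_norm_le w (-I)
  rw [norm_neg, norm_I, sub_neg_eq_add] at this
  linarith

lemma add_I_ne_zero {w : ℂ} (hw : 0 ≤ w.im) : w + I ≠ 0 := by
  intro h
  have := congrArg Complex.im h
  simp at this
  linarith

lemma ofReal_sub_I_ne_zero (t : ℝ) : (t : ℂ) - I ≠ 0 := by
  intro h
  have := congrArg Complex.im h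
  simp at this

lemma continuous_comp_ofReal {h : ℂ → ℂ} (hc : ContinuousOn h {z | 0 ≤ z.im}) :
    Continuous (fun t : ℝ => h t) :=
  hc.comp_continuous continuous_ofReal (by simp)

lemma one_add_ofReal_sq (t : ℝ) : 1 + (t : ℂ) ^ 2 = (t - I) * (t + I) := by
  linear_combination I_sq

/-- Poisson formula at `I` for bounded holomorphic functions on the upper half-plane. -/
lemma integral_poisson {h : ℂ → ℂ} {M : ℝ}
    (hc : ContinuousOn h {z | 0 ≤ z.im}) (hd : DifferentiableOn ℂ h {z | 0 < z.im})
    (hb : ∀ z : ℂ, 0 ≤ z.im → ‖h z‖ ≤ M) :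
    ∫ t : ℝ, h t / (1 + (t : ℂ) ^ 2) = Real.pi * h I := by
  have hI : (0:ℝ) < I.im := by simp
  have hq : ∀ t : ℝ, dslope h I t / (t + I) = h t / (1 + (t : ℂ) ^ 2) - h I / (1 + (t : ℂ) ^ 2) := by
    intro t
    have h1 := ofReal_sub_I_ne_zero t
    have h2 := add_I_ne_zero (w := (t : ℂ)) (by simp)
    rw [dslope_of_ne _ (sub_ne_zero.1 h1), slope_def_field, one_add_ofReal_sq]
    field_simp
  have i1 := integrable_div_one_add_sq (continuous_comp_ofReal hc) (fun t => hb t (by simp))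
  have i2 := integrable_div_one_add_sq (h := fun _ => h I) continuous_const (fun t => le_rfl)
  have key : ∫ t : ℝ, dslope h I t / (t + I) = 0 := by
    refine integral_real_line_eq_zero (q := fun w => dslope h I w / (w + I)) (C := 8 * M) (R₀ := 2)
      ?_ ?_ ?_ ?_
    · refine ContinuousOn.div ?_ (by fun_prop) fun w hw => add_I_ne_zero hw
      exact (continuousOn_dslope (closedUpperHalf_mem_nhds hI)).2
        ⟨hc, hd.differentiableAt (upperHalf_mem_nhds hI)⟩
    · refine DifferentiableOn.div ?_ (by fun_prop) fun w hw => add_I_ne_zero (le_of_lt hw)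
      exact (Complex.differentiableOn_dslope (upperHalf_mem_nhds hI)).2 hd
    · simp only [hq]
      exact i1.sub i2
    · intro w hw h2
      have hne : w ≠ I := by
        rintro rfl
        norm_num at h2
      rw [dslope_of_ne _ hne, slope_def_field, norm_div, norm_div]
      have a1 := half_norm_le_norm_sub_I h2
      have a2 := half_norm_le_norm_add_I h2
      have a3 : ‖h w - h I‖ ≤ 2 * M :=
        (norm_sub_le _ _).trans (by linarith [hb w hw, hb I hI.le])
      have hM : 0 ≤ M := (norm_nonneg _).trans (hb w hw)
      calc ‖h w - h I‖ / ‖w - I‖ / ‖w + I‖ * ‖w‖ ^ 2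
          ≤ 2 * M / (‖w‖ / 2) / (‖w‖ / 2) * ‖w‖ ^ 2 := by
            have : 0 < ‖w‖ := by linarith
            gcongr
        _ = 8 * M := by
            have : ‖w‖ ≠ 0 := by linarith
            field_simp
            ring
  simp only [hq] at key
  rw [integral_sub i1 i2, sub_eq_zero] at key
  rw [key]
  have : ∀ t : ℝ, h I / (1 + (t : ℂ) ^ 2) = (((1 + t ^ 2)⁻¹ : ℝ) : ℂ) * h I := by
    intro t
    push_cast
    ring
  simp only [this]
  rw [integral_mul_const, integral_complex_ofReal, integral_univ_inv_one_add_sq]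

/-- Derivative form of the Poisson formula for functions of linear growth. -/
lemma integral_deriv_poisson {D : ℂ → ℂ} {K : ℝ}
    (hc : ContinuousOn D {z | 0 ≤ z.im}) (hd : DifferentiableOn ℂ D {z | 0 < z.im})
    (hb : ∀ z : ℂ, 0 ≤ z.im → ‖D z - D I‖ ≤ K * ‖z - I‖) :
    2 * ∫ t : ℝ, D t * (t / (1 + (t : ℂ) ^ 2) ^ 2) = Real.pi * deriv D I := by
  have hI : (0:ℝ) < I.im := by simp
  have hK : 0 ≤ K := by
    have := (norm_nonneg _).trans (hb 0 (by simp))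
    simpa using this
  have c1 : ContinuousOn (dslope D I) {z | 0 ≤ z.im} :=
    (continuousOn_dslope (closedUpperHalf_mem_nhds hI)).2
        ⟨hc, hd.differentiableAt (upperHalf_mem_nhds hI)⟩
  have d1 : DifferentiableOn ℂ (dslope D I) {z | 0 < z.im} :=
    (Complex.differentiableOn_dslope (upperHalf_mem_nhds hI)).2 hd
  have b1 : ∀ z : ℂ, 0 ≤ z.im → ‖dslope D I z‖ ≤ K := by
    intro z hz
    by_cases hzI : z = I
    · subst hzI
      rw [dslope_same]
      refine norm_deriv_le_of_lip' hK ?_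
      filter_upwards [closedUpperHalf_mem_nhds hI] with z hz using hb z hz
    · rw [dslope_of_ne _ hzI, slope_def_field, norm_div, div_le_iff₀ (by
        simpa [sub_eq_zero] using hzI)]
      exact hb z hz
  have h1 := integral_poisson c1 d1 b1
  rw [dslope_same] at h1
  have i1 := integrable_div_one_add_sq (continuous_comp_ofReal c1) (fun t => b1 t (by simp))
  have n1 : ∀ t : ℝ, ‖((t : ℂ) + I) ^ 2‖ = 1 + t ^ 2 := by
    intro t
    rw [norm_pow, ← normSq_eq_norm_sq, normSq_apply]
    simp
    ring
  have i2 : Integrable (fun t : ℝ => dslope D I t / (t + I) ^ 2) := by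
    refine i1.mono ?_ (.of_forall fun t => ?_)
    · exact ((continuous_comp_ofReal c1).div (by fun_prop) fun t =>
        pow_ne_zero 2 (add_I_ne_zero (by simp))).aestronglyMeasurable
    · rw [norm_div, norm_div, n1, show (1 + (t : ℂ) ^ 2) = ((1 + t ^ 2 : ℝ) : ℂ) by push_cast; ring,
        norm_real, Real.norm_of_nonneg (by positivity : (0:ℝ) ≤ 1 + t ^ 2)]
  have h2 : ∫ t : ℝ, dslope D I t / (t + I) ^ 2 = 0 := by
    refine integral_real_line_eq_zero (q := fun w => dslope D I w / (w + I) ^ 2)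
      (C := 4 * K) (R₀ := 2) ?_ ?_ i2 ?_
    · exact ContinuousOn.div c1 (by fun_prop) fun w hw => pow_ne_zero 2 (add_I_ne_zero hw)
    · exact DifferentiableOn.div d1 (by fun_prop) fun w hw =>
        pow_ne_zero 2 (add_I_ne_zero (le_of_lt hw))
    · intro w hw h2
      rw [norm_div, norm_pow]
      have a2 := half_norm_le_norm_add_I h2
      calc ‖dslope D I w‖ / ‖w + I‖ ^ 2 * ‖w‖ ^ 2
          ≤ K / (‖w‖ / 2) ^ 2 * ‖w‖ ^ 2 := by
            have : 0 < ‖w‖ := by linarith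
            gcongr
            exact b1 w hw
        _ = 4 * K := by
            have : ‖w‖ ≠ 0 := by linarith
            field_simp
            norm_num
  have hq : ∀ t : ℝ, dslope D I t / (1 + (t : ℂ) ^ 2) + dslope D I t / (t + I) ^ 2 =
      2 * (D t * (t / (1 + (t : ℂ) ^ 2) ^ 2)) - 2 * (D I * (t / (1 + (t : ℂ) ^ 2) ^ 2)) := by
    intro t
    have h1 := ofReal_sub_I_ne_zero t
    have h2 := add_I_ne_zero (w := (t : ℂ)) (by simp)
    rw [dslope_of_ne _ (sub_ne_zero.1 h1), slope_def_field, one_add_ofReal_sq]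
    field_simp
    ring
  have i3 : Integrable (fun t : ℝ => 2 * (D I * ((t : ℂ) / (1 + (t : ℂ) ^ 2) ^ 2))) := by
    have h0 : ∀ t : ℝ, (1 + (t : ℂ) ^ 2) ≠ 0 := by
      intro t
      norm_cast
      positivity
    have := integrable_div_one_add_sq (h := fun t : ℝ => (t : ℂ) / (1 + (t : ℂ) ^ 2)) (M := 1)
      (Continuous.div (by fun_prop) (by fun_prop) h0) ?_
    · refine ((this.const_mul (D I)).const_mul 2).congr (.of_forall fun t => ?_)
      have := h0 t
      simp only
      field_simp
    · intro t
      rw [norm_div, show (1 + (t : ℂ) ^ 2) = ((1 + t ^ 2 : ℝ) : ℂ) by push_cast; ring,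
        norm_real, norm_real, Real.norm_of_nonneg (by positivity : (0:ℝ) ≤ 1 + t ^ 2),
        div_le_one (by positivity), Real.norm_eq_abs]
      nlinarith [abs_nonneg t, sq_abs t]
  have h3 : ∫ t : ℝ, 2 * (D I * ((t : ℂ) / (1 + (t : ℂ) ^ 2) ^ 2)) = 0 := by
    have := integral_neg_eq_self (fun t : ℝ => 2 * (D I * ((t : ℂ) / (1 + (t : ℂ) ^ 2) ^ 2))) volume
    simp only [ofReal_neg, neg_sq, neg_div, mul_neg, integral_neg] at this
    linear_combination (-1/2) * this
  have h4 := integral_add i1 i2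
  simp only [hq] at h4
  have i4 : Integrable (fun t : ℝ => 2 * (D t * ((t : ℂ) / (1 + (t : ℂ) ^ 2) ^ 2))) := by
    refine ((i1.add i2).add i3).congr (.of_forall fun t => ?_)
    simp only [Pi.add_apply]
    rw [hq]
    ring
  rw [integral_sub i4 i3, h3, h1, h2, sub_zero, add_zero, integral_const_mul] at h4
  exact h4

lemma sub_ofReal_ne_zero_of_im_pos {w : ℂ} (hw : 0 < w.im) (t : ℝ) : w - t ≠ 0 := by
  intro h
  have := congrArg Complex.im h
  simp at this
  linarith

/-- Holomorphic functions on the upper half-plane have primitives. -/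
lemma exists_primitive_upperHalf {g : ℂ → ℂ} (hg : DifferentiableOn ℂ g {z | 0 < z.im}) :
    ∃ G : ℂ → ℂ, ∀ z : ℂ, 0 < z.im → HasDerivAt G (g z) z := by
  have h1 : ∀ w ∈ Metric.ball (0 : ℂ) 1, 1 - w ≠ 0 := by
    intro w hw h
    rw [sub_eq_zero] at h
    simp [← h] at hw
  have h2 : MapsTo (fun w : ℂ => I * (1 + w) / (1 - w)) (Metric.ball 0 1) {z | 0 < z.im} := by
    intro w hw
    have hn : 0 < normSq (1 - w) := normSq_pos.2 (h1 w hw)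
    have hw' : normSq w < 1 := by
      rw [normSq_eq_norm_sq]
      rw [mem_ball_zero_iff] at hw
      nlinarith [norm_nonneg w]
    have e : (I * (1 + w) / (1 - w)).im = (1 - normSq w) / normSq (1 - w) := by
      rw [div_im]
      simp [normSq_apply]
      field_simp
      ring
    change 0 < (I * (1 + w) / (1 - w)).im
    rw [e]
    exact div_pos (by linarith) hn
  have h3 : DifferentiableOn ℂ (fun w : ℂ => g (I * (1 + w) / (1 - w)) * (2 * I / (1 - w) ^ 2))
      (Metric.ball 0 1) := by
    refine DifferentiableOn.mul (hg.comp (t := {z | 0 < z.im}) ?_ h2) ?_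
    · exact DifferentiableOn.div (by fun_prop) (by fun_prop) h1
    · exact DifferentiableOn.div (by fun_prop) (by fun_prop) fun w hw => pow_ne_zero 2 (h1 w hw)
  obtain ⟨H, hH⟩ := h3.isExactOn_ball
  refine ⟨fun z => H ((z - I) / (z + I)), fun z hz => ?_⟩
  have hz' : z + I ≠ 0 := add_I_ne_zero hz.le
  have hmem : (z - I) / (z + I) ∈ Metric.ball (0 : ℂ) 1 := by
    rw [mem_ball_zero_iff, norm_div, div_lt_one (norm_pos_iff.2 hz')]
    refine lt_of_pow_lt_pow_left₀ 2 (norm_nonneg _) ?_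
    rw [← normSq_eq_norm_sq, ← normSq_eq_norm_sq, normSq_apply, normSq_apply]
    simp
    nlinarith
  have hd : HasDerivAt (fun z : ℂ => (z - I) / (z + I)) (2 * I / (z + I) ^ 2) z := by
    refine (((hasDerivAt_id z).sub_const I).div ((hasDerivAt_id z).add_const I) hz').congr_deriv ?_
    simp only [id]
    ring
  refine ((hH _ hmem).comp z hd).congr_deriv ?_
  have e1 : 1 - (z - I) / (z + I) = 2 * I / (z + I) := by
    field_simp
    ring
  have e2 : I * (1 + (z - I) / (z + I)) / (2 * I / (z + I)) = z := by
    field_simp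
    ring
  beta_reduce
  rw [e1, e2]
  field_simp

/-- Fatou's theorem: bounded holomorphic functions on the upper half-plane have vertical limits at
almost every boundary point. -/
lemma ae_exists_tendsto_of_bounded {g : ℂ → ℂ} {M : ℝ}
    (hg : DifferentiableOn ℂ g {z | 0 < z.im}) (hb : ∀ z : ℂ, 0 < z.im → ‖g z‖ ≤ M) :
    ∀ᵐ x : ℝ, ∃ L : ℂ, Tendsto (fun ε : ℝ => g (x + ε * I)) (𝓝[>] 0) (𝓝 L) := by
  have hM : 0 ≤ M := (norm_nonneg _).trans (hb I (by simp))
  obtain ⟨G₀, hG₀⟩ := exists_primitive_upperHalf hg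
  have hlip : LipschitzOnWith ⟨M, hM⟩ G₀ {z | 0 < z.im} :=
    (convex_halfSpace_im_gt 0).lipschitzOnWith_of_nnnorm_hasDerivWithin_le
      (fun z hz => (hG₀ z hz).hasDerivWithinAt) (fun z hz => hb z hz)
  obtain ⟨G, hGl, hGe⟩ := hlip.extend_finite_dimension
  set K := lipschitzExtensionConstant ℂ * ⟨M, hM⟩ with hK
  have hG : ∀ z : ℂ, 0 < z.im → HasDerivAt G (g z) z := fun z hz =>
    (hG₀ z hz).congr_of_eventuallyEq (by
      filter_upwards [upperHalf_mem_nhds hz] with w hw using (hGe hw).symm)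
  have hΦ : LipschitzWith K (fun t : ℝ => G t) := by
    have := hGl.comp (Complex.isometry_ofReal.lipschitz)
    rwa [mul_one] at this
  have hformula : ∀ x ε : ℝ, 0 < ε → Real.pi * g (x + ε * I) = 2 * ∫ t : ℝ,
      ((G (x + ε * t) - G x) / ε) * (t / (1 + (t : ℂ) ^ 2) ^ 2) := by
    intro x ε hε
    have hε' : (ε : ℂ) ≠ 0 := by exact_mod_cast hε.ne'
    have hder : ∀ w : ℂ, 0 < w.im →
        HasDerivAt (fun w : ℂ => (G (x + ε * w) - G x) / ε) (g (x + ε * w)) w := by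
      intro w hw
      have him : 0 < (x + ε * w : ℂ).im := by simpa using mul_pos hε hw
      have ha : HasDerivAt (fun w : ℂ => x + ε * w) (ε : ℂ) w := by
        simpa using ((hasDerivAt_id w).const_mul (ε : ℂ)).const_add (x : ℂ)
      refine ((((hG _ him).comp w ha).sub_const (G x)).div_const (ε : ℂ)).congr_deriv ?_
      field_simp
    have := integral_deriv_poisson (D := fun w : ℂ => (G (x + ε * w) - G x) / ε) (K := K) ?_
      (fun w hw => (hder w hw).differentiableAt.differentiableWithinAt) ?_
    · rw [(hder I (by simp)).deriv] at this
      exact this.symm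
    · have := hGl.continuous
      fun_prop
    · intro z _
      rw [← sub_div, norm_div, div_le_iff₀ (norm_pos_iff.2 hε')]
      have := hGl.dist_le_mul (x + ε * z) (x + ε * I)
      rw [dist_eq_norm, dist_eq_norm] at this
      rw [sub_sub_sub_cancel_right]
      refine this.trans_eq ?_
      rw [add_sub_add_left_eq_sub, ← mul_sub, norm_mul]
      ring
  filter_upwards [hΦ.ae_differentiableAt_real] with x hx
  obtain ⟨m, hm⟩ : ∃ m, HasDerivAt (fun t : ℝ => G t) m x := ⟨_, hx.hasDerivAt⟩
  have hlim : Tendsto (fun ε : ℝ => ∫ t : ℝ,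
      ((G (x + ε * t) - G x) / ε) * (t / (1 + (t : ℂ) ^ 2) ^ 2)) (𝓝[>] 0)
      (𝓝 (∫ t : ℝ, (m * t) * (t / (1 + (t : ℂ) ^ 2) ^ 2))) := by
    refine tendsto_integral_filter_of_dominated_convergence (fun t => K * (1 + t ^ 2)⁻¹) ?_ ?_
      (integrable_inv_one_add_sq.const_mul _) ?_
    · refine .of_forall fun ε => Continuous.aestronglyMeasurable ?_
      have := hGl.continuous
      refine Continuous.mul (by fun_prop) (Continuous.div (by fun_prop) (by fun_prop) fun t => ?_)
      refine pow_ne_zero 2 ?_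
      norm_cast
      positivity
    · filter_upwards [self_mem_nhdsWithin] with ε hε
      have hε : 0 < ε := hε
      refine .of_forall fun t => ?_
      have h1 : ‖(G (x + ε * t) - G x) / ε‖ ≤ K * |t| := by
        rw [norm_div, norm_real, Real.norm_of_nonneg hε.le, div_le_iff₀ hε]
        have := hGl.dist_le_mul (x + ε * t) x
        rw [dist_eq_norm, dist_eq_norm] at this
        refine this.trans_eq ?_
        simp [abs_of_pos hε]
        ring
      have h2 : ‖(t / (1 + (t : ℂ) ^ 2) ^ 2)‖ = |t| / (1 + t ^ 2) ^ 2 := by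
        rw [show (t / (1 + (t : ℂ) ^ 2) ^ 2) = ((t / (1 + t ^ 2) ^ 2 : ℝ) : ℂ) by push_cast; ring,
          norm_real, Real.norm_eq_abs, abs_div, abs_of_nonneg (by positivity : 0 ≤ (1 + t ^ 2) ^ 2)]
      rw [norm_mul, h2]
      calc _ ≤ K * |t| * (|t| / (1 + t ^ 2) ^ 2) := by gcongr
        _ = K * (t ^ 2 / (1 + t ^ 2) ^ 2) := by rw [← sq_abs t]; ring
        _ ≤ K * (1 + t ^ 2)⁻¹ := by
          gcongr
          rw [div_le_iff₀ (by positivity)]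
          field_simp
          linarith
    · refine .of_forall fun t => Tendsto.mul_const _ ?_
      have h1 : HasDerivAt (fun ε : ℝ => G ((x + ε * t : ℝ) : ℂ)) (t • m) 0 := by
        have ha : HasDerivAt (fun ε : ℝ => x + ε * t) t 0 := by
          simpa using ((hasDerivAt_id (0:ℝ)).mul_const t).const_add x
        have hm' : HasDerivAt (fun t : ℝ => G t) m (x + 0 * t) := by simpa using hm
        exact hm'.scomp (0:ℝ) ha
      have h2 := h1.tendsto_slope_zero_right
      refine (h2.congr fun ε => ?_).trans_eq ?_
      · simp
        ring
      · simp [mul_comm]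
  refine ⟨(2 / Real.pi) * ∫ t : ℝ, (m * t) * (t / (1 + (t : ℂ) ^ 2) ^ 2), ?_⟩
  refine (hlim.const_mul (2 / (Real.pi : ℂ))).congr' ?_
  filter_upwards [self_mem_nhdsWithin] with ε hε
  have := hformula x ε hε
  have hp : (Real.pi : ℂ) ≠ 0 := by exact_mod_cast Real.pi_ne_zero
  rw [div_mul_eq_mul_div, ← this]
  field_simp

lemma add_ofReal_mul_I_im (x ε : ℝ) : (x + ε * I : ℂ).im = ε := by simp

/-- Poisson formula at `(y + ε) I`, with boundary values taken on the line `im = ε`. -/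
lemma integral_poisson_shift {h : ℂ → ℂ} {M ε y : ℝ} (hε : 0 < ε) (hy : 0 < y)
    (hd : DifferentiableOn ℂ h {z | 0 < z.im}) (hb : ∀ z : ℂ, ε ≤ z.im → ‖h z‖ ≤ M) :
    Integrable (fun t : ℝ => h (t + ε * I) * (((1 + (t / y) ^ 2)⁻¹ : ℝ) : ℂ)) ∧
    ∫ t : ℝ, h (t + ε * I) * (((1 + (t / y) ^ 2)⁻¹ : ℝ) : ℂ) = Real.pi * y * h ((y + ε) * I) := by
  have him : ∀ z : ℂ, 0 ≤ z.im → ε ≤ (y * z + ε * I : ℂ).im := by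
    intro z hz
    simpa using mul_nonneg hy.le hz
  have hdiff : DifferentiableOn ℂ (fun z : ℂ => h (y * z + ε * I)) {z | 0 ≤ z.im} := by
    refine hd.comp (by fun_prop) fun z hz => ?_
    exact hε.trans_le (him z hz)
  have key := integral_poisson (h := fun z => h (y * z + ε * I)) (M := M) hdiff.continuousOn
    (hdiff.mono fun z (hz : 0 < z.im) => hz.le) (fun z hz => hb _ (him z hz))
  have hint := integrable_div_one_add_sq (h := fun t : ℝ => h (y * t + ε * I)) (M := M)
    (continuous_comp_ofReal hdiff.continuousOn) (fun t => hb _ (him t (by simp)))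
  have e : ∀ t : ℝ, h (y * t + ε * I) / (1 + (t : ℂ) ^ 2) =
      (fun s : ℝ => h (s + ε * I) * (((1 + (s / y) ^ 2)⁻¹ : ℝ) : ℂ)) (y * t) := by
    intro t
    have : y * t / y = t := by field_simp
    simp only [this]
    push_cast
    rw [div_eq_mul_inv]
  have hcv := Measure.integral_comp_mul_left
    (fun s : ℝ => h (s + ε * I) * (((1 + (s / y) ^ 2)⁻¹ : ℝ) : ℂ)) y
  simp only [← e] at hcv
  simp only [e] at hint
  refine ⟨(integrable_comp_mul_left_iff _ hy.ne').1 hint, ?_⟩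
  rw [key, abs_of_pos (inv_pos.2 hy)] at hcv
  have hy' : (y : ℂ) ≠ 0 := by exact_mod_cast hy.ne'
  rw [add_mul, mul_right_comm, hcv]
  simp only [real_smul, ofReal_inv]
  field_simp

lemma tendsto_inv_nat_nhdsGT : Tendsto (fun n : ℕ => 1 / ((n : ℝ) + 1)) atTop (𝓝[>] 0) :=
  tendsto_nhdsWithin_iff.2 ⟨tendsto_one_div_add_atTop_nhds_zero_nat,
    .of_forall fun n => by simp only [mem_Ioi]; positivity⟩

lemma continuous_vertical_shift {h : ℂ → ℂ} {ε : ℝ} (hε : 0 < ε)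
    (hd : DifferentiableOn ℂ h {z | 0 < z.im}) : Continuous (fun t : ℝ => h (t + ε * I)) :=
  hd.continuousOn.comp_continuous (by fun_prop) (by simpa using hε)

lemma lintegral_liminf_re_le {g : ℂ → ℂ} {M : ℝ} (hd : DifferentiableOn ℂ g {z | 0 < z.im})
    (hb : ∀ z : ℂ, 0 < z.im → ‖g z‖ ≤ M) (hre : ∀ z : ℂ, 0 < z.im → 0 ≤ (g z).re) :
    ∫⁻ t : ℝ, liminf (fun n : ℕ => ENNReal.ofReal (g (t + (1 / ((n : ℝ) + 1) : ℝ) * I)).re) atTop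
      ∂(volume.withDensity fun t : ℝ => ENNReal.ofReal (1 + t ^ 2)⁻¹) ≤
    ENNReal.ofReal (Real.pi * (g I).re) := by
  have hpos : ∀ n : ℕ, 0 < 1 / ((n : ℝ) + 1) := fun n => by positivity
  have hm : ∀ n : ℕ, Measurable fun t : ℝ =>
      ENNReal.ofReal (g (t + (1 / ((n : ℝ) + 1) : ℝ) * I)).re := fun n =>
    (measurable_re.comp (continuous_vertical_shift (hpos n) hd).measurable).ennreal_ofReal
  refine (lintegral_liminf_le hm).trans ?_
  have hw : Measurable fun t : ℝ => ENNReal.ofReal (1 + t ^ 2)⁻¹ := by fun_prop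
  have e : ∀ n : ℕ, ∫⁻ t : ℝ, ENNReal.ofReal (g (t + (1 / ((n : ℝ) + 1) : ℝ) * I)).re
      ∂(volume.withDensity fun t : ℝ => ENNReal.ofReal (1 + t ^ 2)⁻¹) =
      ENNReal.ofReal (Real.pi * (g ((1 + (1 / ((n : ℝ) + 1) : ℝ)) * I)).re) := by
    intro n
    rw [lintegral_withDensity_eq_lintegral_mul _ hw (hm n)]
    obtain ⟨i1, i2⟩ := integral_poisson_shift (hpos n) one_pos hd
      (fun z hz => hb z ((hpos n).trans_le hz))
    have i3 := congrArg Complex.re i2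
    simp only [ofReal_one, mul_one, re_ofReal_mul, div_one] at i3 i1
    rw [← i3, ← reCLM_apply, ← ContinuousLinearMap.integral_comp_comm _ i1,
      ofReal_integral_eq_lintegral_ofReal (reCLM.integrable_comp i1)]
    · refine lintegral_congr fun t => ?_
      simp only [Pi.mul_apply, reCLM_apply, re_mul_ofReal]
      rw [← ENNReal.ofReal_mul (by positivity), mul_comm]
    · refine .of_forall fun t => ?_
      simp only [reCLM_apply, re_mul_ofReal, Pi.zero_apply]
      exact mul_nonneg (hre _ ((add_ofReal_mul_I_im t _).symm ▸ hpos n)) (by positivity)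
  simp only [e]
  refine (Tendsto.liminf_eq ?_).le
  refine ENNReal.tendsto_ofReal (Tendsto.const_mul _ ?_)
  refine (continuous_re.tendsto _).comp ?_
  refine ((hd.differentiableAt (upperHalf_mem_nhds (by simp))).continuousAt.tendsto.comp ?_)
  have : Tendsto (fun n : ℕ => ((1 + (1 / ((n : ℝ) + 1) : ℝ)) * I : ℂ)) atTop
      (𝓝 ((1 + (0:ℝ)) * I)) :=
    ((continuous_ofReal.tendsto _).comp tendsto_one_div_add_atTop_nhds_zero_nat).const_add 1
      |>.mul_const I
  simpa using this

lemma add_real_mul_I_ne_zero {w : ℂ} {N : ℝ} (hw : 0 ≤ w.im) (hN : 0 < N) : w + N * I ≠ 0 := by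
  intro h
  have := congrArg Complex.im h
  simp at this
  linarith

/-- A holomorphic function from the upper half-plane to its closure has finite vertical limits at
almost every boundary point. -/
lemma ae_exists_tendsto_of_im_nonneg {F : ℂ → ℂ}
    (hF : DifferentiableOn ℂ F {z | 0 < z.im}) (him : ∀ z : ℂ, 0 < z.im → 0 ≤ (F z).im) :
    ∀ᵐ x : ℝ, ∃ L : ℂ, Tendsto (fun ε : ℝ => F (x + ε * I)) (𝓝[>] 0) (𝓝 L) := by
  have hv : ∀ x : ℝ, ∀ᶠ ε : ℝ in 𝓝[>] 0, 0 < (x + ε * I : ℂ).im := by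
    intro x
    filter_upwards [self_mem_nhdsWithin] with ε hε
    simpa using hε
  have hne : ∀ z : ℂ, 0 < z.im → F z + I ≠ 0 := fun z hz => add_I_ne_zero (him z hz)
  have hg : DifferentiableOn ℂ (fun z => 1 / (F z + I)) {z | 0 < z.im} :=
    DifferentiableOn.div (by fun_prop) (hF.add_const I) hne
  have hgb : ∀ z : ℂ, 0 < z.im → ‖1 / (F z + I)‖ ≤ 1 := by
    intro z hz
    rw [norm_div, norm_one, div_le_one (norm_pos_iff.2 (hne z hz))]
    refine le_trans ?_ (im_le_norm _)
    simpa using him z hz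
  set B : Set ℝ := {x | Tendsto (fun ε : ℝ => 1 / (F (x + ε * I) + I)) (𝓝[>] 0) (𝓝 0)} with hB
  set μ : Measure ℝ := volume.withDensity fun t : ℝ => ENNReal.ofReal (1 + t ^ 2)⁻¹ with hμ
  have hbound : ∀ N : ℕ, μ B ≤
      ENNReal.ofReal (Real.pi * (F I / (F I + ((N + 1 : ℝ) : ℂ) * I)).re) := by
    intro N
    have hN : (0:ℝ) < N + 1 := by positivity
    have hne' : ∀ z : ℂ, 0 < z.im → F z + ((N + 1 : ℝ) : ℂ) * I ≠ 0 :=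
      fun z hz => add_real_mul_I_ne_zero (him z hz) hN
    have h1 := lintegral_liminf_re_le (g := fun z => F z / (F z + ((N + 1 : ℝ) : ℂ) * I)) (M := 1)
      (DifferentiableOn.div hF (hF.add_const _) hne') ?_ ?_
    · refine le_trans ?_ h1
      refine le_trans ?_ (mul_meas_ge_le_lintegral ?_ 1)
      · rw [one_mul]
        refine measure_mono fun x hx => ?_
        change (1 : ENNReal) ≤ liminf _ atTop
        refine le_of_eq (Tendsto.liminf_eq ?_).symm
        rw [← ENNReal.ofReal_one]
        refine ENNReal.tendsto_ofReal ?_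
        have hx' : Tendsto (fun ε : ℝ => 1 / (F (x + ε * I) + I)) (𝓝[>] 0) (𝓝 0) := hx
        have h2 : Tendsto (fun ε : ℝ => F (x + ε * I) / (F (x + ε * I) + ((N + 1 : ℝ) : ℂ) * I))
            (𝓝[>] 0) (𝓝 ((1 - I * 0) / (1 + I * N * 0))) := by
          refine (((hx'.const_mul I).const_sub 1).div ((hx'.const_mul (I * N)).const_add 1)
            (by simp)).congr' ?_
          filter_upwards [hv x] with ε hε
          have a1 := hne _ hε
          have a2 := hne' _ hε
          simp only [Pi.div_apply]
          generalize F (x + ε * I) = w at a1 a2 ⊢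
          have e1 : 1 - I * (1 / (w + I)) = w / (w + I) := by
            field_simp
            ring
          have e2 : 1 + I * N * (1 / (w + I)) = (w + ((N + 1 : ℝ) : ℂ) * I) / (w + I) := by
            field_simp
            push_cast
            ring
          rw [e1, e2, div_div_div_cancel_right₀ a1]
        have h3 := (continuous_re.tendsto _).comp (h2.comp tendsto_inv_nat_nhdsGT)
        simpa [Function.comp_def] using h3
      · refine Measurable.liminf fun n => ?_
        exact (measurable_re.comp (continuous_vertical_shift (by positivity)
          (DifferentiableOn.div hF (hF.add_const _) hne')).measurable).ennreal_ofReal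
    · intro z hz
      rw [norm_div, div_le_one (norm_pos_iff.2 (hne' z hz))]
      refine le_of_pow_le_pow_left₀ two_ne_zero (norm_nonneg _) ?_
      rw [← normSq_eq_norm_sq, ← normSq_eq_norm_sq, normSq_apply, normSq_apply]
      have := him z hz
      simp
      nlinarith
    · intro z hz
      rw [div_re, ← add_div]
      refine div_nonneg ?_ (normSq_nonneg _)
      have := him z hz
      simp
      nlinarith [mul_nonneg this hN.le, mul_self_nonneg (F z).re, mul_self_nonneg (F z).im]
  have hB0 : μ B = 0 := by
    refine le_antisymm (ge_of_tendsto' (?_ : Tendsto _ atTop _) hbound) zero_le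
    rw [← ENNReal.ofReal_zero]
    refine ENNReal.tendsto_ofReal ?_
    rw [← mul_zero Real.pi]
    refine Tendsto.const_mul _ ?_
    rw [← zero_re]
    refine (continuous_re.tendsto _).comp ?_
    have h1 : Tendsto (fun N : ℕ => F I / ((F I + I) / N + I) * ((N : ℂ))⁻¹) atTop
        (𝓝 (F I / (0 + I) * 0)) := by
      have := tendsto_inv_atTop_nhds_zero_nat (𝕜 := ℂ)
      refine Tendsto.mul (Tendsto.div tendsto_const_nhds ?_ (by simp)) this
      refine Tendsto.add_const _ ?_
      simpa [div_eq_mul_inv] using this.const_mul (F I + I)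
    rw [mul_zero] at h1
    refine h1.congr' ?_
    filter_upwards [eventually_ne_atTop 0] with N hN
    have : (N : ℂ) ≠ 0 := by exact_mod_cast hN
    have e : (F I + I) / N + I = (F I + ((N + 1 : ℝ) : ℂ) * I) / N := by
      field_simp
      push_cast
      ring
    rw [e]
    have := add_real_mul_I_ne_zero (him I (by simp)) (by positivity : (0:ℝ) < N + 1)
    field_simp
  have hB1 : volume B = 0 := by
    refine withDensity_absolutelyContinuous' (by fun_prop) ?_ hB0
    refine .of_forall fun t => ?_
    rw [ne_eq, ENNReal.ofReal_eq_zero, not_le]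
    positivity
  filter_upwards [ae_exists_tendsto_of_bounded hg hgb, measure_eq_zero_iff_ae_notMem.1 hB1]
    with x ⟨L, hL⟩ hxB
  have hL0 : L ≠ 0 := by
    rintro rfl
    exact hxB hL
  refine ⟨1 / L - I, ((tendsto_const_nhds.div hL hL0).sub_const I).congr' ?_⟩
  filter_upwards [hv x] with ε hε
  have := hne _ hε
  simp only [Pi.div_apply]
  field_simp
  ring

lemma ofReal_sub_ne_zero_of_im_pos {z : ℂ} (hz : 0 < z.im) (t : ℝ) : (t : ℂ) - z ≠ 0 := by
  rw [← neg_sub, neg_ne_zero]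
  exact sub_ofReal_ne_zero_of_im_pos hz t

lemma nevanlinna_kernel_eq {z : ℂ} (hz : 0 < z.im) (t : ℝ) :
    (1 + z * (t : ℂ)) / ((t : ℂ) - z) = z + (1 + z ^ 2) * resolvent z t := by
  have h := ofReal_sub_ne_zero_of_im_pos hz t
  rw [resolvent, coe_algebraMap, Ring.inverse_eq_inv]
  field_simp
  ring

lemma notMem_image_support {ρ : Measure ℝ} {z : ℂ} (hz : 0 < z.im) :
    z ∉ algebraMap ℝ ℂ '' ρ.support := by
  rintro ⟨t, -, rfl⟩
  simp at hz

lemma integrable_nevanlinna_kernel {ρ : Measure ℝ} [IsFiniteMeasure ρ] {z : ℂ} (hz : 0 < z.im) :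
    Integrable (fun t : ℝ => (1 + z * (t : ℂ)) / ((t : ℂ) - z)) ρ := by
  simp only [nevanlinna_kernel_eq hz]
  exact (integrable_const z).add ((integrable_resolvent (notMem_image_support hz)).const_mul _)

lemma nevanlinna_kernel_im (x y t : ℝ) :
    ((1 + (x + y * I : ℂ) * (t : ℂ)) / ((t : ℂ) - (x + y * I))).im =
      (1 + t ^ 2) * y / ((t - x) ^ 2 + y ^ 2) := by
  rw [div_im, ← sub_div]
  congr 1
  · simp
    ring
  · simp [normSq_apply]
    ring

lemma nevanlinna_kernel_im_nonneg {y : ℝ} (hy : 0 ≤ y) (x t : ℝ) :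
    0 ≤ (1 + t ^ 2) * y / ((t - x) ^ 2 + y ^ 2) := by positivity

lemma differentiableOn_nevanlinna (β : ℝ) (ρ : Measure ℝ) [IsFiniteMeasure ρ] {f : ℂ → ℂ}
    (hf : ∀ z : ℂ, 0 < z.im →
      f z = z + (β : ℂ) + ∫ t, (1 + z * (t : ℂ)) / ((t : ℂ) - z) ∂ρ) :
    DifferentiableOn ℂ f {z | 0 < z.im} := by
  have h1 : DifferentiableOn ℂ (resolventTransform ρ) {z : ℂ | 0 < z.im} :=
    (analyticOn_resolventTransform (μ := ρ)).differentiableOn.mono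
      fun z hz => notMem_image_support hz
  have h2 : DifferentiableOn ℂ (fun z : ℂ => z + β + (ρ.real univ * z +
      (1 + z ^ 2) * resolventTransform ρ z)) {z | 0 < z.im} := by fun_prop
  refine h2.congr fun z hz => ?_
  rw [hf z hz]
  simp only [nevanlinna_kernel_eq hz]
  rw [integral_add (integrable_const z)
    ((integrable_resolvent (notMem_image_support hz)).const_mul _), integral_const,
    integral_const_mul, resolventTransform_apply, real_smul]

lemma ofReal_nevanlinna_im (β : ℝ) (ρ : Measure ℝ) [IsFiniteMeasure ρ] {f : ℂ → ℂ}
    (hf : ∀ z : ℂ, 0 < z.im →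
      f z = z + (β : ℂ) + ∫ t, (1 + z * (t : ℂ)) / ((t : ℂ) - z) ∂ρ) (x : ℝ) {y : ℝ} (hy : 0 < y) :
    y ≤ (f (x + y * I)).im ∧ ENNReal.ofReal (f (x + y * I)).im =
      ENNReal.ofReal y + ∫⁻ t, ENNReal.ofReal ((1 + t ^ 2) * y / ((t - x) ^ 2 + y ^ 2)) ∂ρ := by
  have hz : 0 < (x + y * I : ℂ).im := by simpa using hy
  have hint := integrable_nevanlinna_kernel (ρ := ρ) hz
  have e : (f (x + y * I)).im = y + ∫ t, (1 + t ^ 2) * y / ((t - x) ^ 2 + y ^ 2) ∂ρ := by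
    rw [hf _ hz, add_im, ← imCLM_apply (∫ t, _ ∂ρ), ← ContinuousLinearMap.integral_comp_comm _ hint]
    simp only [imCLM_apply, nevanlinna_kernel_im]
    simp
  have hint' := imCLM.integrable_comp hint
  simp only [imCLM_apply, nevanlinna_kernel_im] at hint'
  have hn : 0 ≤ ∫ t, (1 + t ^ 2) * y / ((t - x) ^ 2 + y ^ 2) ∂ρ :=
    integral_nonneg fun t => nevanlinna_kernel_im_nonneg hy.le x t
  rw [e]
  refine ⟨by linarith, ?_⟩
  rw [ENNReal.ofReal_add hy.le hn, ofReal_integral_eq_lintegral_ofReal hint'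
    (.of_forall fun t => nevanlinna_kernel_im_nonneg hy.le x t)]

lemma nevanlinna_im_pos (β : ℝ) (ρ : Measure ℝ) [IsFiniteMeasure ρ] {f : ℂ → ℂ}
    (hf : ∀ z : ℂ, 0 < z.im →
      f z = z + (β : ℂ) + ∫ t, (1 + z * (t : ℂ)) / ((t : ℂ) - z) ∂ρ) {z : ℂ} (hz : 0 < z.im) :
    z.im ≤ (f z).im := by
  have := (ofReal_nevanlinna_im β ρ hf z.re hz).1
  rwa [re_add_im] at this

lemma tendsto_nevanlinna_div (β : ℝ) (ρ : Measure ℝ) [IsFiniteMeasure ρ] {f : ℂ → ℂ}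
    (hf : ∀ z : ℂ, 0 < z.im →
      f z = z + (β : ℂ) + ∫ t, (1 + z * (t : ℂ)) / ((t : ℂ) - z) ∂ρ) :
    Tendsto (fun y : ℝ => f (y * I) / (y * I)) atTop (𝓝 1) := by
  have hinv : Tendsto (fun y : ℝ => ((y : ℂ))⁻¹) atTop (𝓝 0) := by
    have := (continuous_ofReal.tendsto 0).comp tendsto_inv_atTop_zero
    simpa [Function.comp_def] using this
  have h1 : Tendsto (fun y : ℝ => ∫ t, (1 + (y * I) * (t : ℂ)) / ((t : ℂ) - y * I) / (y * I) ∂ρ)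
      atTop (𝓝 (∫ _, (0 : ℂ) ∂ρ)) := by
    refine tendsto_integral_filter_of_dominated_convergence (fun _ => 1) ?_ ?_
      (integrable_const _) ?_
    · filter_upwards [eventually_gt_atTop 0] with y hy
      exact ((integrable_nevanlinna_kernel (z := y * I) (by simpa using hy)).div_const
        _).aestronglyMeasurable
    · filter_upwards [eventually_ge_atTop 1] with y hy
      refine .of_forall fun t => ?_
      have h0 : (t : ℂ) - y * I ≠ 0 :=
        ofReal_sub_ne_zero_of_im_pos (z := y * I) (by simp; linarith) t
      have hyI : (y * I : ℂ) ≠ 0 := by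
        simp
        linarith
      rw [div_div, norm_div, div_le_one (norm_pos_iff.2 (mul_ne_zero h0 hyI))]
      refine le_of_pow_le_pow_left₀ two_ne_zero (norm_nonneg _) ?_
      rw [← normSq_eq_norm_sq, ← normSq_eq_norm_sq, normSq_mul, normSq_apply, normSq_apply,
        normSq_apply]
      simp
      have h2 : 1 ≤ y ^ 2 := by nlinarith
      nlinarith [sq_nonneg t]
    · refine .of_forall fun t => ?_
      have h2 : Tendsto (fun y : ℝ => ((y : ℂ)⁻¹ + I * t) / ((t : ℂ) * (y : ℂ)⁻¹ - I) * (y : ℂ)⁻¹ / I)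
          atTop (𝓝 ((0 + I * t) / (t * 0 - I) * 0 / I)) :=
        (((hinv.add_const _).div ((hinv.const_mul _).sub_const I) (by simp)).mul hinv).div_const I
      rw [mul_zero, zero_div] at h2
      refine h2.congr' ?_
      filter_upwards [eventually_gt_atTop 0] with y hy
      have h0 : (t : ℂ) - y * I ≠ 0 :=
        ofReal_sub_ne_zero_of_im_pos (z := y * I) (by simpa using hy) t
      have hy' : (y : ℂ) ≠ 0 := by exact_mod_cast hy.ne'
      have e1 : (t : ℂ) * (y : ℂ)⁻¹ - I = (t - y * I) / y := by
        field_simp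
      rw [e1]
      field_simp
  rw [integral_zero] at h1
  have h2 : Tendsto (fun y : ℝ => 1 + β / I * (y : ℂ)⁻¹ +
      ∫ t, (1 + (y * I) * (t : ℂ)) / ((t : ℂ) - y * I) / (y * I) ∂ρ) atTop
      (𝓝 (1 + β / I * 0 + 0)) := ((hinv.const_mul _).const_add 1).add h1
  rw [mul_zero, add_zero, add_zero] at h2
  refine h2.congr' ?_
  filter_upwards [eventually_gt_atTop 0] with y hy
  have hy' : (y : ℂ) ≠ 0 := by exact_mod_cast hy.ne'
  rw [hf _ (by simpa using hy), integral_div]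
  field_simp

lemma lintegral_cauchy_kernel {ε : ℝ} (hε : 0 < ε) (t : ℝ) :
    ∫⁻ x : ℝ, ENNReal.ofReal (ε / ((t - x) ^ 2 + ε ^ 2)) = ENNReal.ofReal Real.pi := by
  have e : ∀ x : ℝ, ε / ((t - x) ^ 2 + ε ^ 2) =
      (fun u => ε⁻¹ * (fun v => (1 + v ^ 2)⁻¹) (u / ε)) (x - t) := by
    intro x
    simp only
    rw [show (t - x) ^ 2 = (x - t) ^ 2 by ring, div_pow]
    field_simp
    ring
  have hint : Integrable (fun u : ℝ => ε⁻¹ * (fun v : ℝ => (1 + v ^ 2)⁻¹) (u / ε)) :=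
    (integrable_inv_one_add_sq.comp_div hε.ne').const_mul _
  simp only [e]
  rw [← ofReal_integral_eq_lintegral_ofReal (hint.comp_sub_right t)
    (.of_forall fun x => by simp only [Pi.zero_apply]; positivity),
    integral_sub_right_eq_self (fun u : ℝ => ε⁻¹ * (fun v : ℝ => (1 + v ^ 2)⁻¹) (u / ε)) t,
    integral_const_mul, Measure.integral_comp_div (fun v : ℝ => (1 + v ^ 2)⁻¹),
    integral_univ_inv_one_add_sq, abs_of_pos hε, smul_eq_mul, inv_mul_cancel_left₀ hε.ne']

lemma one_add_sq_le (x t : ℝ) : 1 + t ^ 2 ≤ 2 * (1 + x ^ 2) + 2 * (t - x) ^ 2 := by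
  nlinarith [sq_nonneg (t - 2 * x)]

lemma lintegral_nevanlinna_kernel_le {ε : ℝ} (hε : 0 < ε) (hε1 : ε ≤ 1) (t : ℝ) :
    ∫⁻ x : ℝ, ENNReal.ofReal ((1 + t ^ 2) * ε / ((t - x) ^ 2 + ε ^ 2))
      ∂(volume.withDensity fun t : ℝ => ENNReal.ofReal (1 + t ^ 2)⁻¹) ≤
      ENNReal.ofReal (4 * Real.pi) := by
  rw [lintegral_withDensity_eq_lintegral_mul _ (by fun_prop) (by fun_prop)]
  have h1 : ∀ x : ℝ, (1 + x ^ 2)⁻¹ * ((1 + t ^ 2) * ε / ((t - x) ^ 2 + ε ^ 2)) ≤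
      2 * (ε / ((t - x) ^ 2 + ε ^ 2)) + 2 * (1 / ((0 - x) ^ 2 + 1 ^ 2)) := by
    intro x
    have h2 : 0 < (t - x) ^ 2 + ε ^ 2 := by positivity
    have e : (0 - x) ^ 2 + 1 ^ 2 = 1 + x ^ 2 := by ring
    rw [e, inv_mul_eq_div, div_div, ← mul_div_assoc, ← mul_div_assoc,
      div_add_div _ _ h2.ne' (by positivity), mul_comm ((t - x) ^ 2 + ε ^ 2) (1 + x ^ 2)]
    gcongr
    have h3 := mul_le_mul_of_nonneg_right (one_add_sq_le x t) hε.le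
    have h4 := mul_le_mul_of_nonneg_left hε1 (sq_nonneg (t - x))
    nlinarith [sq_nonneg ε]
  have hp := Real.pi_pos
  calc _ ≤ ∫⁻ x : ℝ, (ENNReal.ofReal 2 * ENNReal.ofReal (ε / ((t - x) ^ 2 + ε ^ 2)) +
        ENNReal.ofReal 2 * ENNReal.ofReal (1 / ((0 - x) ^ 2 + 1 ^ 2))) := by
        refine lintegral_mono fun x => ?_
        rw [Pi.mul_apply, ← ENNReal.ofReal_mul (by positivity), ← ENNReal.ofReal_mul (by positivity),
          ← ENNReal.ofReal_mul (by positivity), ← ENNReal.ofReal_add (by positivity) (by positivity)]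
        exact ENNReal.ofReal_le_ofReal (h1 x)
    _ = ENNReal.ofReal (4 * Real.pi) := by
        rw [lintegral_add_left (by fun_prop), lintegral_const_mul _ (by fun_prop),
          lintegral_const_mul _ (by fun_prop), lintegral_cauchy_kernel hε,
          lintegral_cauchy_kernel one_pos, ← ENNReal.ofReal_mul (by positivity),
          ← ENNReal.ofReal_add (by positivity) (by positivity)]
        congr 1
        ring

lemma tendsto_setLIntegral_nevanlinna_kernel {ρ : Measure ℝ} [IsFiniteMeasure ρ] {K : Set ℝ}
    (hK : IsClosed K) {x : ℝ} (hx : x ∉ K) :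
    Tendsto (fun n : ℕ => ∫⁻ t in K, ENNReal.ofReal
      ((1 + t ^ 2) * (1 / ((n : ℝ) + 1)) / ((t - x) ^ 2 + (1 / ((n : ℝ) + 1)) ^ 2)) ∂ρ) atTop
      (𝓝 0) := by
  obtain ⟨δ, hδ, hball⟩ := Metric.isOpen_iff.1 hK.isOpen_compl x hx
  have hdist : ∀ t ∈ K, δ ^ 2 ≤ (t - x) ^ 2 := by
    intro t ht
    have : δ ≤ |t - x| := by
      by_contra! h
      exact hball (by rwa [Metric.mem_ball, Real.dist_eq]) ht
    rw [← sq_abs (t - x)]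
    gcongr
  set C := 2 * (1 + x ^ 2) / δ ^ 2 + 2 with hC
  have hbd : ∀ n : ℕ, ∫⁻ t in K, ENNReal.ofReal
      ((1 + t ^ 2) * (1 / ((n : ℝ) + 1)) / ((t - x) ^ 2 + (1 / ((n : ℝ) + 1)) ^ 2)) ∂ρ ≤
      ENNReal.ofReal (C * (1 / ((n : ℝ) + 1))) * ρ K := by
    intro n
    rw [← setLIntegral_const]
    refine setLIntegral_mono' hK.measurableSet fun t ht => ENNReal.ofReal_le_ofReal ?_
    set ε := 1 / ((n : ℝ) + 1) with hε
    have hε0 : 0 < ε := by positivity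
    have h1 := hdist t ht
    have h2 : 0 < (t - x) ^ 2 := lt_of_lt_of_le (by positivity) h1
    rw [div_le_iff₀ (by positivity)]
    have h3 : 2 * (1 + x ^ 2) ≤ 2 * (1 + x ^ 2) / δ ^ 2 * (t - x) ^ 2 := by
      rw [div_mul_eq_mul_div, le_div_iff₀ (by positivity)]
      gcongr
    have h4 : 1 + t ^ 2 ≤ C * (t - x) ^ 2 := by
      rw [hC]
      linarith [one_add_sq_le x t]
    have hC0 : 0 ≤ C := by positivity
    calc (1 + t ^ 2) * ε ≤ C * (t - x) ^ 2 * ε := by gcongr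
      _ ≤ C * ((t - x) ^ 2 + ε ^ 2) * ε := by gcongr; linarith [sq_nonneg ε]
      _ = _ := by ring
  refine tendsto_of_tendsto_of_tendsto_of_le_of_le tendsto_const_nhds ?_ (fun n => zero_le) hbd
  have h0 : Tendsto (fun n : ℕ => ENNReal.ofReal (C * (1 / ((n : ℝ) + 1)))) atTop (𝓝 0) := by
    have := ENNReal.tendsto_ofReal (tendsto_one_div_add_atTop_nhds_zero_nat.const_mul C)
    simpa using this
  have := ENNReal.Tendsto.mul_const (b := ρ K) h0 (.inr (measure_ne_top _ _))
  simpa using this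

lemma ae_volume_of_ae_withDensity {p : ℝ → Prop}
    (h : ∀ᵐ x ∂(volume.withDensity fun t : ℝ => ENNReal.ofReal (1 + t ^ 2)⁻¹), p x) :
    ∀ᵐ x : ℝ, p x := by
  refine (withDensity_absolutelyContinuous' (by fun_prop) (.of_forall fun t => ?_)).ae_le h
  rw [ne_eq, ENNReal.ofReal_eq_zero, not_le]
  positivity

/-- The imaginary part of the transform of a singular measure has vanishing lower limits. -/
lemma ae_liminf_nevanlinna_im_eq_zero (β : ℝ) (ρ : Measure ℝ) [IsFiniteMeasure ρ]
    (hsing : ρ ⟂ₘ (volume : Measure ℝ)) {f : ℂ → ℂ}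
    (hf : ∀ z : ℂ, 0 < z.im →
      f z = z + (β : ℂ) + ∫ t, (1 + z * (t : ℂ)) / ((t : ℂ) - z) ∂ρ) :
    ∀ᵐ x : ℝ, liminf (fun n : ℕ =>
      ENNReal.ofReal (f (x + (1 / ((n : ℝ) + 1) : ℝ) * I)).im) atTop = 0 := by
  have hpos : ∀ n : ℕ, 0 < 1 / ((n : ℝ) + 1) := fun n => by positivity
  have hle1 : ∀ n : ℕ, 1 / ((n : ℝ) + 1) ≤ 1 := fun n => by
    rw [div_le_one (by positivity)]
    simp
  set μ : Measure ℝ := volume.withDensity fun t : ℝ => ENNReal.ofReal (1 + t ^ 2)⁻¹ with hμ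
  set p : ℕ → ℝ → ℝ → ENNReal := fun n x t => ENNReal.ofReal
      ((1 + t ^ 2) * (1 / ((n : ℝ) + 1)) / ((t - x) ^ 2 + (1 / ((n : ℝ) + 1)) ^ 2)) with hp
  have hpm : ∀ n, Measurable (Function.uncurry (p n)) := fun n => by
    simp only [hp, Function.uncurry_def]
    fun_prop
  have hd := differentiableOn_nevanlinna β ρ hf
  have hm : ∀ n : ℕ, Measurable fun x : ℝ =>
      ENNReal.ofReal (f (x + (1 / ((n : ℝ) + 1) : ℝ) * I)).im := fun n =>
    (measurable_im.comp (continuous_vertical_shift (hpos n) hd).measurable).ennreal_ofReal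
  have hbound : ∀ η : ENNReal, η ≠ 0 → ∫⁻ x, liminf (fun n : ℕ =>
      ENNReal.ofReal (f (x + (1 / ((n : ℝ) + 1) : ℝ) * I)).im) atTop ∂μ ≤
      ENNReal.ofReal (4 * Real.pi) * η := by
    intro η hη
    obtain ⟨K, hKs, hK, hKη⟩ :=
      hsing.measurableSet_nullSet.compl.exists_isClosed_sdiff_lt (measure_ne_top ρ _) hη
    have hK0 : volume K = 0 := measure_mono_null hKs hsing.measure_compl_nullSet
    have hKc : ρ Kᶜ ≤ η := by
      refine le_trans ?_ hKη.le
      calc ρ Kᶜ ≤ ρ (hsing.nullSet ∪ (hsing.nullSetᶜ \ K)) := by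
            refine measure_mono fun x hx => ?_
            by_cases h : x ∈ hsing.nullSet
            · exact .inl h
            · exact .inr ⟨h, hx⟩
        _ ≤ _ := (measure_union_le _ _).trans (by rw [hsing.measure_nullSet, zero_add])
    have hKμ : μ K = 0 := withDensity_absolutelyContinuous _ _ hK0
    calc _ ≤ ∫⁻ x, liminf (fun n : ℕ => ∫⁻ t in Kᶜ, p n x t ∂ρ) atTop ∂μ := by
          refine lintegral_mono_ae ?_
          filter_upwards [measure_eq_zero_iff_ae_notMem.1 hKμ] with x hx
          have e : ∀ n : ℕ, ENNReal.ofReal (f (x + (1 / ((n : ℝ) + 1) : ℝ) * I)).im =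
              (ENNReal.ofReal (1 / ((n : ℝ) + 1)) + ∫⁻ t in K, p n x t ∂ρ) +
                ∫⁻ t in Kᶜ, p n x t ∂ρ := by
            intro n
            rw [(ofReal_nevanlinna_im β ρ hf x (hpos n)).2, add_assoc,
              lintegral_add_compl _ hK.measurableSet]
          simp only [e]
          have h0 : Tendsto (fun n : ℕ => ENNReal.ofReal (1 / ((n : ℝ) + 1)) +
              ∫⁻ t in K, p n x t ∂ρ) atTop (𝓝 0) := by
            have := (ENNReal.tendsto_ofReal tendsto_one_div_add_atTop_nhds_zero_nat).add
              (tendsto_setLIntegral_nevanlinna_kernel (ρ := ρ) hK hx)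
            rwa [ENNReal.ofReal_zero, zero_add] at this
          exact (ENNReal.liminf_add_of_left_tendsto_zero h0 _).le
      _ ≤ liminf (fun n : ℕ => ∫⁻ x, ∫⁻ t in Kᶜ, p n x t ∂ρ ∂μ) atTop :=
          lintegral_liminf_le fun n => (hpm n).lintegral_prod_right'
      _ ≤ ENNReal.ofReal (4 * Real.pi) * η := by
          refine liminf_le_of_le (by isBoundedDefault) fun b hb => ?_
          obtain ⟨n, hn⟩ := hb.exists
          refine hn.trans ?_
          rw [lintegral_lintegral_swap (hpm n).aemeasurable]
          calc _ ≤ ∫⁻ _ in Kᶜ, ENNReal.ofReal (4 * Real.pi) ∂ρ :=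
                lintegral_mono fun t => lintegral_nevanlinna_kernel_le (hpos n) (hle1 n) t
            _ ≤ _ := by
                rw [setLIntegral_const]
                gcongr
  have hzero : ∫⁻ x, liminf (fun n : ℕ =>
      ENNReal.ofReal (f (x + (1 / ((n : ℝ) + 1) : ℝ) * I)).im) atTop ∂μ = 0 := by
    refine le_antisymm ?_ zero_le
    have h1 : Tendsto (fun n : ℕ => ENNReal.ofReal (4 * Real.pi) * ENNReal.ofReal (1 / ((n : ℝ) + 1)))
        atTop (𝓝 (ENNReal.ofReal (4 * Real.pi) * ENNReal.ofReal 0)) :=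
      ENNReal.Tendsto.const_mul
        (ENNReal.tendsto_ofReal tendsto_one_div_add_atTop_nhds_zero_nat) (.inr ENNReal.ofReal_ne_top)
    rw [ENNReal.ofReal_zero, mul_zero] at h1
    exact ge_of_tendsto' h1 fun n => hbound _ (by
      rw [ne_eq, ENNReal.ofReal_eq_zero, not_le]
      exact hpos n)
  exact ae_volume_of_ae_withDensity ((lintegral_eq_zero_iff (.liminf hm)).1 hzero)

lemma sub_ofReal_div_im (c d : ℝ) (w : ℂ) :
    ((w - d) / (w - c)).im = (d - c) * w.im / normSq (w - c) := by
  rw [div_im]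
  simp only [sub_im, sub_re, ofReal_im, ofReal_re, sub_zero]
  ring

lemma sub_ofReal_div_im_pos {c d : ℝ} (hcd : c < d) {w : ℂ} (hw : 0 < w.im) :
    0 < ((w - d) / (w - c)).im := by
  rw [sub_ofReal_div_im]
  have := normSq_pos.2 (sub_ofReal_ne_zero_of_im_pos hw c)
  have := sub_pos.2 hcd
  positivity

lemma norm_sub_ofReal_div_le (c d : ℝ) {ε : ℝ} (hε : 0 < ε) {w : ℂ} (hw : ε ≤ w.im) :
    ‖(w - d) / (w - c)‖ ≤ 1 + |c - d| / ε := by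
  have hc := sub_ofReal_ne_zero_of_im_pos (hε.trans_le hw) c
  have e : (w - d) / (w - c) = 1 + ((c - d : ℝ) : ℂ) / (w - c) := by
    rw [ofReal_sub]
    field_simp
    ring
  have h1 : ε ≤ ‖w - c‖ := by
    refine hw.trans ((le_abs_self _).trans ?_)
    simpa using abs_im_le_norm (w - c)
  rw [e]
  refine (norm_add_le _ _).trans ?_
  rw [norm_one, norm_div, norm_real, Real.norm_eq_abs]
  gcongr

lemma norm_log_sub_ofReal_div_le (c d : ℝ) {ε : ℝ} (hε : 0 < ε) {w : ℂ} (hw : ε ≤ w.im) :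
    ‖log ((w - d) / (w - c))‖ ≤ |c - d| / ε + Real.pi := by
  have hc := sub_ofReal_ne_zero_of_im_pos (hε.trans_le hw) c
  have hd := sub_ofReal_ne_zero_of_im_pos (hε.trans_le hw) d
  have h1 := norm_sub_ofReal_div_le c d hε hw
  have h2 := norm_sub_ofReal_div_le d c hε hw
  have h0 : 0 < ‖(w - d) / (w - c)‖ := norm_pos_iff.2 (div_ne_zero hd hc)
  rw [← inv_div, norm_inv, abs_sub_comm] at h2
  refine (norm_le_abs_re_add_abs_im _).trans (add_le_add ?_ ?_)
  · rw [log_re, abs_le]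
    constructor
    · have := Real.log_le_sub_one_of_pos (inv_pos.2 h0)
      rw [Real.log_inv] at this
      linarith
    · linarith [Real.log_le_sub_one_of_pos h0]
  · rw [log_im]
    exact abs_arg_le_pi _

/-- The argument of `(w - d) / (w - c)` tends to `π` times the indicator of `(c, d)` at
real boundary points other than `c` and `d`. -/
lemma tendsto_arg_sub_ofReal_div {c d : ℝ} (hcd : c < d) {L : ℝ} (hLc : L ≠ c) (hLd : L ≠ d)
    {w : ℕ → ℂ} (hw : ∀ n, 0 < (w n).im) (hL : Tendsto w atTop (𝓝 (L : ℂ))) :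
    Tendsto (fun n => arg ((w n - d) / (w n - c))) atTop
      (𝓝 ((Ioo c d).indicator (fun _ => Real.pi) L)) := by
  have hne : (L : ℂ) - c ≠ 0 := sub_ne_zero.2 (ofReal_injective.ne hLc)
  have h1 : Tendsto (fun n => (w n - d) / (w n - c)) atTop (𝓝 (((L - d) / (L - c) : ℝ) : ℂ)) := by
    push_cast
    exact (hL.sub_const _).div (hL.sub_const _) hne
  by_cases h : L ∈ Ioo c d
  · rw [indicator_of_mem h]
    have hre : (L - d) / (L - c) < 0 :=
      div_neg_of_neg_of_pos (sub_neg.2 h.2) (sub_pos.2 h.1)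
    have h2 := continuousWithinAt_arg_of_re_neg_of_im_zero
      (z := (((L - d) / (L - c) : ℝ) : ℂ)) (by rwa [ofReal_re]) (ofReal_im _)
    have h3 := h2.tendsto.comp (tendsto_nhdsWithin_iff.2 ⟨h1, .of_forall fun n =>
      (sub_ofReal_div_im_pos hcd (hw n)).le⟩)
    rwa [arg_ofReal_of_neg hre] at h3
  · rw [indicator_of_notMem h]
    have hre : 0 < (L - d) / (L - c) := by
      rcases lt_or_gt_of_ne hLc with h4 | h4
      · exact div_pos_of_neg_of_neg (by linarith) (by linarith)
      · rcases lt_or_gt_of_ne hLd with h5 | h5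
        · exact absurd ⟨h4, h5⟩ h
        · exact div_pos (by linarith) (by linarith)
    have h2 := (continuousAt_arg (ofReal_mem_slitPlane.2 hre)).tendsto.comp h1
    rwa [arg_ofReal_of_nonneg hre.le] at h2

lemma ae_exists_tendsto_nevanlinna (β : ℝ) (ρ : Measure ℝ) [IsFiniteMeasure ρ]
    (hsing : ρ ⟂ₘ (volume : Measure ℝ)) {f : ℂ → ℂ}
    (hf : ∀ z : ℂ, 0 < z.im →
      f z = z + (β : ℂ) + ∫ t, (1 + z * (t : ℂ)) / ((t : ℂ) - z) ∂ρ) :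
    ∀ᵐ x : ℝ, ∃ L : ℝ, Tendsto (fun ε : ℝ => f (x + ε * I)) (𝓝[>] 0) (𝓝 (L : ℂ)) := by
  filter_upwards [ae_exists_tendsto_of_im_nonneg (differentiableOn_nevanlinna β ρ hf)
    (fun z hz => hz.le.trans (nevanlinna_im_pos β ρ hf hz)),
    ae_liminf_nevanlinna_im_eq_zero β ρ hsing hf] with x ⟨L, hL⟩ hx
  have h1 : Tendsto (fun n : ℕ => (f (x + (1 / ((n : ℝ) + 1) : ℝ) * I)).im) atTop (𝓝 L.im) :=
    (continuous_im.tendsto L).comp (hL.comp tendsto_inv_nat_nhdsGT)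
  have h2 : 0 ≤ L.im := ge_of_tendsto' h1 fun n => by
    have h3 : 0 < ((x : ℂ) + (1 / ((n : ℝ) + 1) : ℝ) * I).im := by
      rw [add_ofReal_mul_I_im]
      positivity
    exact h3.le.trans (nevanlinna_im_pos β ρ hf h3)
  rw [(ENNReal.tendsto_ofReal h1).liminf_eq, ENNReal.ofReal_eq_zero] at hx
  refine ⟨L.re, ?_⟩
  rwa [show (L.re : ℂ) = L from Complex.ext rfl (by rw [ofReal_im]; exact le_antisymm h2 hx)]

lemma ae_not_tendsto_ofReal {f : ℂ → ℂ} (hd : DifferentiableOn ℂ f {z | 0 < z.im})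
    (him : ∀ z, 0 < z.im → 0 < (f z).im) (c : ℝ) :
    ∀ᵐ x : ℝ, ¬ Tendsto (fun ε : ℝ => f (x + ε * I)) (𝓝[>] 0) (𝓝 (c : ℂ)) := by
  have hne : ∀ z, 0 < z.im → f z - c ≠ 0 := fun z hz => sub_ofReal_ne_zero_of_im_pos (him z hz) c
  filter_upwards [ae_exists_tendsto_of_im_nonneg (F := fun z => -(f z - c)⁻¹)
    ((hd.sub_const _).inv hne).neg (fun z hz => by
      rw [neg_im, inv_im, sub_im, ofReal_im, sub_zero, ← neg_div, neg_neg]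
      have := him z hz
      have := normSq_nonneg (f z - c)
      positivity)] with x ⟨L, hL⟩ h
  have h1 := hL.mul (h.sub_const (c : ℂ))
  rw [sub_self, mul_zero] at h1
  have h2 : Tendsto (fun _ : ℝ => (-1 : ℂ)) (𝓝[>] 0) (𝓝 0) := by
    refine h1.congr' ?_
    filter_upwards [self_mem_nhdsWithin] with ε hε
    rw [neg_mul, inv_mul_cancel₀ (hne _ (by rwa [add_ofReal_mul_I_im]))]
  exact neg_ne_zero.2 one_ne_zero (tendsto_nhds_unique tendsto_const_nhds h2)

lemma tendsto_mul_arg_sub_ofReal_div (c d : ℝ) (hcd : c ≠ d) {w : ℝ → ℂ}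
    (him : ∀ y, 0 < y → 0 < (w y).im)
    (hw : Tendsto (fun y : ℝ => w y / (y * I)) atTop (𝓝 1)) :
    Tendsto (fun y : ℝ => y * arg ((w y - d) / (w y - c))) atTop (𝓝 (d - c)) := by
  have h1 : Tendsto (fun y : ℝ => (y : ℂ) / (w y - c)) atTop (𝓝 (-I)) := by
    have h2 : Tendsto (fun y : ℝ => (c : ℂ) * ((y⁻¹ : ℝ) : ℂ)) atTop (𝓝 0) := by
      simpa using ((continuous_ofReal.tendsto 0).comp tendsto_inv_atTop_zero).const_mul (c : ℂ)
    have h3 := ((hw.mul_const I).sub h2).inv₀ (by simp)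
    rw [one_mul, sub_zero, inv_I] at h3
    refine h3.congr' ?_
    filter_upwards [eventually_gt_atTop 0] with y hy
    have hy' : (y : ℂ) ≠ 0 := ofReal_ne_zero.2 hy.ne'
    rw [← inv_div (w y - c) (y : ℂ), inv_inj, ofReal_inv]
    field_simp
  set s : ℝ → ℂ := fun y => ((c - d : ℝ) : ℂ) / (w y - c) with hs
  have h4 : Tendsto (fun y : ℝ => (y : ℂ) * s y) atTop (𝓝 ((d - c : ℝ) * I)) := by
    have := h1.const_mul ((c - d : ℝ) : ℂ)
    rw [show ((c - d : ℝ) : ℂ) * -I = (d - c : ℝ) * I by push_cast; ring] at this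
    exact this.congr fun y => by simp only [hs]; ring
  have h5 : Tendsto s atTop (𝓝 0) := by
    have h6 : Tendsto (fun y : ℝ => ((y⁻¹ : ℝ) : ℂ)) atTop (𝓝 0) :=
      (continuous_ofReal.tendsto 0).comp tendsto_inv_atTop_zero
    have := h6.mul h4
    rw [zero_mul] at this
    refine this.congr' ?_
    filter_upwards [eventually_gt_atTop 0] with y hy
    have hy' : (y : ℂ) ≠ 0 := ofReal_ne_zero.2 hy.ne'
    rw [ofReal_inv, inv_mul_cancel_left₀ hy']
  have hs0 : ∀ᶠ y in atTop, s y ∈ ({0}ᶜ : Set ℂ) := by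
    filter_upwards [eventually_gt_atTop 0] with y hy
    exact div_ne_zero (ofReal_ne_zero.2 (sub_ne_zero.2 hcd))
      (sub_ofReal_ne_zero_of_im_pos (him y hy) c)
  have h7 := (hasDerivAt_iff_tendsto_slope_zero.1 (hasDerivAt_log one_mem_slitPlane)).comp
    (tendsto_nhdsWithin_iff.2 ⟨h5, hs0⟩)
  have h8 := (continuous_im.tendsto _).comp (h7.mul h4)
  rw [inv_one, one_mul, ← real_smul, real_smul, im_ofReal_mul, I_im, mul_one] at h8
  refine h8.congr' ?_
  filter_upwards [eventually_gt_atTop 0, hs0] with y hy hsy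
  have hc := sub_ofReal_ne_zero_of_im_pos (him y hy) c
  have e : (w y - d) / (w y - c) = 1 + s y := by
    simp only [hs]
    rw [ofReal_sub]
    field_simp
    ring
  have hsy' : s y ≠ 0 := hsy
  have e2 : (s y)⁻¹ * log (1 + s y) * (y * s y) = y * log (1 + s y) := by
    field_simp
  simp only [Function.comp_apply, log_one, sub_zero, smul_eq_mul]
  rw [e2, im_ofReal_mul, log_im, e]

/-- The Poisson integral of the preimage of `(c, d)` is a harmonic measure. -/
lemma lintegral_poisson_preimage {f : ℂ → ℂ} (hd : DifferentiableOn ℂ f {z | 0 < z.im})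
    (him : ∀ z, 0 < z.im → z.im ≤ (f z).im) {ℓ : ℝ → ℝ} (hℓ : Measurable ℓ)
    (hlim : ∀ᵐ x : ℝ, Tendsto (fun n : ℕ => f (x + (1 / ((n : ℝ) + 1) : ℝ) * I)) atTop
      (𝓝 (ℓ x : ℂ))) {c d : ℝ} (hcd : c < d) (hc : ∀ᵐ x, ℓ x ≠ c) (hd' : ∀ᵐ x, ℓ x ≠ d)
    {y : ℝ} (hy : 0 < y) :
    ∫⁻ x in ℓ ⁻¹' Ioo c d, ENNReal.ofReal (1 + (x / y) ^ 2)⁻¹ =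
      ENNReal.ofReal (y * arg ((f (y * I) - d) / (f (y * I) - c))) := by
  have hpos : ∀ n : ℕ, 0 < 1 / ((n : ℝ) + 1) := fun n => by positivity
  have hfp : ∀ z, 0 < z.im → 0 < (f z).im := fun z hz => hz.trans_le (him z hz)
  have hg : DifferentiableOn ℂ (fun z => log ((f z - d) / (f z - c))) {z | 0 < z.im} :=
    ((hd.sub_const _).div (hd.sub_const _) fun z hz =>
      sub_ofReal_ne_zero_of_im_pos (hfp z hz) c).clog fun z hz =>
        .inr (sub_ofReal_div_im_pos hcd (hfp z hz)).ne'
  have hint := integrable_inv_one_add_sq.comp_div hy.ne'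
  have key : ∀ n : ℕ, ∫ t : ℝ, arg ((f (t + (1 / ((n : ℝ) + 1) : ℝ) * I) - d) /
      (f (t + (1 / ((n : ℝ) + 1) : ℝ) * I) - c)) * (1 + (t / y) ^ 2)⁻¹ =
      Real.pi * y * arg ((f ((y + (1 / ((n : ℝ) + 1) : ℝ)) * I) - d) /
        (f ((y + (1 / ((n : ℝ) + 1) : ℝ)) * I) - c)) := by
    intro n
    obtain ⟨h1, h2⟩ := integral_poisson_shift (hpos n) hy hg fun z hz =>
      norm_log_sub_ofReal_div_le c d (hpos n)
        (hz.trans (him z ((hpos n).trans_le hz)))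
    have h3 := congrArg im h2
    rw [← ofReal_mul, im_ofReal_mul, log_im] at h3
    rw [← h3]
    have h4 := imCLM.integral_comp_comm h1
    simp only [imCLM_apply, im_mul_ofReal, log_im] at h4
    exact h4
  have hlimL : Tendsto (fun n : ℕ => ∫ t : ℝ, arg ((f (t + (1 / ((n : ℝ) + 1) : ℝ) * I) - d) /
      (f (t + (1 / ((n : ℝ) + 1) : ℝ) * I) - c)) * (1 + (t / y) ^ 2)⁻¹) atTop
      (𝓝 (∫ t : ℝ, (Ioo c d).indicator (fun _ => Real.pi) (ℓ t) * (1 + (t / y) ^ 2)⁻¹)) := by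
    refine tendsto_integral_of_dominated_convergence
      (fun t => Real.pi * (1 + (t / y) ^ 2)⁻¹) (fun n => ?_) (hint.const_mul _)
      (fun n => .of_forall fun t => ?_) ?_
    · have h1 := (continuous_vertical_shift (hpos n) hd).measurable
      exact (((h1.sub_const _).div (h1.sub_const _)).carg.mul (by fun_prop)).aestronglyMeasurable
    · rw [norm_mul, Real.norm_eq_abs, Real.norm_of_nonneg (by positivity)]
      gcongr
      exact abs_arg_le_pi _
    · filter_upwards [hlim, hc, hd'] with x hx hxc hxd
      exact (tendsto_arg_sub_ofReal_div hcd hxc hxd (fun n => hfp _ (by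
        rw [add_ofReal_mul_I_im]; exact hpos n)) hx).mul_const _
  have hyI : 0 < ((y : ℂ) * I).im := by simpa using hy
  have hlimR : Tendsto (fun n : ℕ => Real.pi * y *
      arg ((f ((y + (1 / ((n : ℝ) + 1) : ℝ)) * I) - d) /
        (f ((y + (1 / ((n : ℝ) + 1) : ℝ)) * I) - c))) atTop
      (𝓝 (Real.pi * y * arg ((f (y * I) - d) / (f (y * I) - c)))) := by
    have h0 : Tendsto (fun n : ℕ => ((y : ℂ) + (1 / ((n : ℝ) + 1) : ℝ)) * I) atTop
        (𝓝 (y * I)) := by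
      have := (((continuous_ofReal.tendsto 0).comp
        tendsto_one_div_add_atTop_nhds_zero_nat).const_add (y : ℂ)).mul_const I
      rwa [ofReal_zero, add_zero] at this
    have h1 := ((hg.differentiableAt (upperHalf_mem_nhds hyI)).continuousAt.tendsto).comp h0
    simpa only [Function.comp_def, log_im] using
      ((continuous_im.tendsto _).comp h1).const_mul (Real.pi * y)
  have heq := tendsto_nhds_unique (hlimL.congr key) hlimR
  have hE : MeasurableSet (ℓ ⁻¹' Ioo c d) := hℓ measurableSet_Ioo
  have e : ∀ t, (Ioo c d).indicator (fun _ => Real.pi) (ℓ t) * (1 + (t / y) ^ 2)⁻¹ =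
      Real.pi * (ℓ ⁻¹' Ioo c d).indicator (fun t => (1 + (t / y) ^ 2)⁻¹) t := by
    intro t
    by_cases h : ℓ t ∈ Ioo c d
    · rw [indicator_of_mem h, indicator_of_mem (mem_preimage.2 h)]
    · rw [indicator_of_notMem h, indicator_of_notMem (by exact h), zero_mul, mul_zero]
  simp only [e] at heq
  rw [integral_const_mul, integral_indicator hE, mul_assoc] at heq
  rw [← mul_left_cancel₀ Real.pi_ne_zero heq, ofReal_integral_eq_lintegral_ofReal hint.integrableOn]
  exact .of_forall fun t => by simp only [Pi.zero_apply]; positivity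

lemma tendsto_setLIntegral_inv_one_add_div_sq {E : Set ℝ} :
    Tendsto (fun n : ℕ => ∫⁻ x in E, ENNReal.ofReal (1 + (x / ((n : ℝ) + 1)) ^ 2)⁻¹) atTop
      (𝓝 (volume E)) := by
  rw [← setLIntegral_one]
  refine lintegral_tendsto_of_tendsto_of_monotone (fun n => by fun_prop)
    (.of_forall fun x m n hmn => ENNReal.ofReal_le_ofReal ?_) (.of_forall fun x => ?_)
  · have : (m : ℝ) ≤ n := Nat.cast_le.2 hmn
    simp only [div_pow]
    gcongr
  · have h1 : Tendsto (fun n : ℕ => (1 + (x * (1 / ((n : ℝ) + 1))) ^ 2)⁻¹) atTop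
        (𝓝 (1 + (x * 0) ^ 2)⁻¹) :=
      (((tendsto_one_div_add_atTop_nhds_zero_nat.const_mul x).pow 2).const_add 1).inv₀ (by simp)
    have h2 := ENNReal.tendsto_ofReal h1
    simpa [div_eq_mul_inv] using h2

/-- (Boole–Letac) If `f(z) = z + β + ∫ (1+zt)/(t−z) dρ(t)` on `ℂ⁺` with `ρ` a finite
positive Borel measure singular with respect to Lebesgue measure, then for almost every
`x ∈ ℝ` the boundary value `lim_{ε↓0} f(x+iε)` exists and is real, and `f` preserves
Lebesgue measure on the boundary: the measure of `{x : f(x) ∈ (c,d)}` is `d − c`. -/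
theorem boole_letac (β : ℝ) (ρ : Measure ℝ) [IsFiniteMeasure ρ]
    (hsing : ρ ⟂ₘ (volume : Measure ℝ))
    (f : ℂ → ℂ)
    (hf : ∀ z : ℂ, 0 < z.im →
      f z = z + (β : ℂ) + ∫ t, (1 + z * (t : ℂ)) / ((t : ℂ) - z) ∂ρ) :
    (∀ᵐ (x : ℝ) ∂(volume : Measure ℝ), ∃ L : ℝ,
        Tendsto (fun ε : ℝ => f ((x : ℂ) + (ε : ℂ) * Complex.I)) (𝓝[>] 0) (𝓝 (L : ℂ))) ∧
    ∀ c d : ℝ, c < d →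
      volume {x : ℝ | ∃ L : ℝ,
          Tendsto (fun ε : ℝ => f ((x : ℂ) + (ε : ℂ) * Complex.I)) (𝓝[>] 0) (𝓝 (L : ℂ)) ∧
          L ∈ Set.Ioo c d}
        = ENNReal.ofReal (d - c) := by
  have hae := ae_exists_tendsto_nevanlinna β ρ hsing hf
  refine ⟨hae, fun c d hcd => ?_⟩
  have hd := differentiableOn_nevanlinna β ρ hf
  have him : ∀ z, 0 < z.im → z.im ≤ (f z).im := fun z hz => nevanlinna_im_pos β ρ hf hz
  have hfp : ∀ z, 0 < z.im → 0 < (f z).im := fun z hz => hz.trans_le (him z hz)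
  have hpos : ∀ n : ℕ, 0 < 1 / ((n : ℝ) + 1) := fun n => by positivity
  have hre : ∀ (x L : ℝ), Tendsto (fun ε : ℝ => f (x + ε * I)) (𝓝[>] 0) (𝓝 (L : ℂ)) →
      Tendsto (fun n : ℕ => (f (x + (1 / ((n : ℝ) + 1) : ℝ) * I)).re) atTop (𝓝 L) :=
    fun x L hL => (continuous_re.tendsto _).comp (hL.comp tendsto_inv_nat_nhdsGT)
  obtain ⟨ℓ, hℓ, hℓlim⟩ := measurable_limit_of_tendsto_metrizable_ae (μ := (volume : Measure ℝ))
    (L := atTop) (f := fun (n : ℕ) (x : ℝ) => (f (x + (1 / ((n : ℝ) + 1) : ℝ) * I)).re)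
    (fun n => (measurable_re.comp (continuous_vertical_shift (hpos n) hd).measurable).aemeasurable)
    (hae.mono fun x ⟨L, hL⟩ => ⟨L, hre x L hL⟩)
  have hlim : ∀ᵐ x : ℝ, Tendsto (fun ε : ℝ => f (x + ε * I)) (𝓝[>] 0) (𝓝 (ℓ x : ℂ)) := by
    filter_upwards [hae, hℓlim] with x ⟨L, hL⟩ hx
    rwa [← tendsto_nhds_unique (hre x L hL) hx]
  have hne : ∀ a : ℝ, ∀ᵐ x, ℓ x ≠ a := fun a => by
    filter_upwards [hlim, ae_not_tendsto_ofReal hd hfp a] with x hx hxa h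
    exact hxa (h ▸ hx)
  have hset : {x : ℝ | ∃ L : ℝ, Tendsto (fun ε : ℝ => f ((x : ℂ) + (ε : ℂ) * I)) (𝓝[>] 0)
      (𝓝 (L : ℂ)) ∧ L ∈ Ioo c d} =ᵐ[volume] ℓ ⁻¹' Ioo c d := by
    filter_upwards [hlim] with x hx
    refine propext ⟨fun ⟨L, hL, hmem⟩ => ?_, fun h => ⟨ℓ x, hx, h⟩⟩
    have := ofReal_injective (tendsto_nhds_unique hL hx)
    exact mem_preimage.2 (this ▸ hmem)
  rw [measure_congr hset]
  refine tendsto_nhds_unique tendsto_setLIntegral_inv_one_add_div_sq ?_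
  have h1 := (tendsto_mul_arg_sub_ofReal_div c d hcd.ne (w := fun y => f (y * I))
    (fun y hy => hfp _ (by simpa using hy)) (tendsto_nevanlinna_div β ρ hf)).comp
    (tendsto_natCast_atTop_atTop.atTop_add (tendsto_const_nhds (x := (1 : ℝ))))
  refine (ENNReal.tendsto_ofReal h1).congr fun n => ?_
  exact (lintegral_poisson_preimage hd him hℓ
    (hlim.mono fun x hx => hx.comp tendsto_inv_nat_nhdsGT) hcd (hne c) (hne d)
    (y := (n : ℝ) + 1) (by positivity)).symm
end

section
/- (Boole–Hruščev–Vinogradov) Let μ be a finite positive Borel measure on ℝ, singular with respect to Lebesgue measure, and let G_μ(z) = ∫_ℝ dμ(t)/(z−t) for z ∈ ℂ⁺ be its Cauchy transform, whose boundary values G_μ(x) = lim_{ε↓0} G_μ(x+iε) exist and are real for Lebesgue-almost every x ∈ ℝ. Then for every y > 0, the Lebesgue measure of {x ∈ ℝ : G_μ(x) > y} equals μ(ℝ)/y, and the Lebesgue measure of {x ∈ ℝ : G_μ(x) < −y} also equals μ(ℝ)/y. -/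
open Complex MeasureTheory Set Filter Topology

/-- The Poisson formula at `I` for a bounded function holomorphic on a neighbourhood of the
closed upper half-plane. -/
lemma integral_inv_one_add_sq_mul_eq_pi_mul {f : ℂ → ℂ} {M : ℝ}
    (hf : ∀ z : ℂ, 0 ≤ z.im → DifferentiableAt ℂ f z) (hM : ∀ z : ℂ, 0 ≤ z.im → ‖f z‖ ≤ M) :
    ∫ s : ℝ, (((1 + s ^ 2)⁻¹ : ℝ) : ℂ) * f s = Real.pi * f I := by
  have hM0 : 0 ≤ M := (norm_nonneg _).trans (hM 0 (by simp))
  have hcont : Continuous fun s : ℝ => f s := by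
    refine continuous_iff_continuousAt.2 fun s => ?_
    exact (hf s (by simp)).continuousAt.comp continuous_ofReal.continuousAt
  have hfi : Integrable fun s : ℝ => (((1 + s ^ 2)⁻¹ : ℝ) : ℂ) * f s := by
    refine (integrable_inv_one_add_sq.ofReal).mul_bdd (c := M) hcont.aestronglyMeasurable ?_
    exact Eventually.of_forall fun s => hM s (by simp)
  have hint2 : Integrable fun s : ℝ => (((1 + s ^ 2)⁻¹ : ℝ) : ℂ) * f I :=
    (integrable_inv_one_add_sq.ofReal).mul_const _
  set k : ℂ → ℂ := fun w => dslope f I w * (w + I)⁻¹ with hk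
  have hne : ∀ w : ℂ, 0 ≤ w.im → w + I ≠ 0 := by
    intro w hw h
    have := congrArg Complex.im h
    simp at this
    linarith
  have hkreal : ∀ s : ℝ,
      k s = (((1 + s ^ 2)⁻¹ : ℝ) : ℂ) * f s - (((1 + s ^ 2)⁻¹ : ℝ) : ℂ) * f I := by
    intro s
    have h1 : (s : ℂ) ≠ I := by
      intro h
      have := congrArg Complex.im h
      simp at this
    have h2 : (s : ℂ) - I ≠ 0 := sub_ne_zero.2 h1
    have h3 : (s : ℂ) + I ≠ 0 := hne s (by simp)
    have h4 : (1 + (s : ℂ) ^ 2) = (s - I) * (s + I) := by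
      ring_nf
      simp [I_sq]
      ring
    simp only [hk, dslope_of_ne _ h1, slope_def_field]
    push_cast
    rw [h4]
    field_simp
  have hkI : Integrable fun s : ℝ => k s := by
    simp_rw [hkreal]
    exact hfi.sub hint2
  have hkd : ∀ z : ℂ, 0 ≤ z.im → z ≠ I → DifferentiableAt ℂ k z := by
    intro z hz hzI
    refine DifferentiableAt.mul ((differentiableAt_dslope_of_ne hzI).2 (hf z hz)) ?_
    exact (differentiableAt_id.add_const _).inv (hne z hz)
  have hkc : ∀ z : ℂ, 0 ≤ z.im → ContinuousAt k z := by
    intro z hz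
    by_cases hzI : z = I
    · subst hzI
      refine ContinuousAt.mul (continuousAt_dslope_same.2 (hf I hz)) ?_
      exact (continuousAt_id.add continuousAt_const).inv₀ (hne I hz)
    · exact (hkd z hz hzI).continuousAt
  have hkb : ∀ (z : ℂ) (r : ℝ), 0 ≤ z.im → 0 < r → r ≤ ‖z - I‖ → r ≤ ‖z + I‖ →
      ‖k z‖ ≤ 2 * M / r ^ 2 := by
    intro z r hz hr h1 h2
    have hzI : z ≠ I := by
      rintro rfl
      simp at h1
      linarith
    simp only [hk, dslope_of_ne _ hzI, slope_def_field, norm_mul, norm_inv, norm_div]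
    have h3 : ‖f z - f I‖ ≤ 2 * M := by
      have := norm_sub_le (f z) (f I)
      have := hM z hz
      have := hM I (by simp)
      linarith
    calc ‖f z - f I‖ / ‖z - I‖ * ‖z + I‖⁻¹ ≤ 2 * M / r * r⁻¹ := by gcongr
      _ = 2 * M / r ^ 2 := by field_simp
  have hrect : ∀ R : ℝ, 1 < R → ‖∫ x : ℝ in (-R)..R, k x‖ ≤ 8 * M * R / (R - 1) ^ 2 := by
    intro R hR
    have hR0 : 0 < R - 1 := by linarith
    have key := integral_boundary_rect_eq_zero_of_differentiable_on_off_countable k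
      (-R : ℝ) ((R : ℝ) + (R : ℝ) * I) {I} (countable_singleton _) ?_ ?_
    · simp at key
      have e1 : ‖∫ x : ℝ in (-R)..R, k (x + R * I)‖ ≤ 2 * M / (R - 1) ^ 2 * |R - -R| := by
        refine intervalIntegral.norm_integral_le_of_norm_le_const fun x _ => ?_
        refine hkb _ _ (by simp; linarith) hR0 ?_ ?_
        · refine le_trans ?_ (abs_im_le_norm _)
          simp [abs_of_pos hR0]
        · refine le_trans ?_ (abs_im_le_norm _)
          simp
          rw [abs_of_pos (by linarith)]; linarith
      have e2 : ‖∫ y : ℝ in (0 : ℝ)..R, k (R + y * I)‖ ≤ 2 * M / (R - 1) ^ 2 * |R - 0| := by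
        refine intervalIntegral.norm_integral_le_of_norm_le_const fun y hy => ?_
        rw [uIoc_of_le (by linarith)] at hy
        refine hkb _ _ (by simp; exact hy.1.le) hR0 ?_ ?_ <;>
        · refine le_trans ?_ (abs_re_le_norm _)
          simp [abs_of_pos (show 0 < R by linarith)]
      have e3 : ‖∫ y : ℝ in (0 : ℝ)..R, k (-R + y * I)‖ ≤ 2 * M / (R - 1) ^ 2 * |R - 0| := by
        refine intervalIntegral.norm_integral_le_of_norm_le_const fun y hy => ?_
        rw [uIoc_of_le (by linarith)] at hy
        refine hkb _ _ (by simp; exact hy.1.le) hR0 ?_ ?_ <;>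
        · refine le_trans ?_ (abs_re_le_norm _)
          simp [abs_of_pos (show 0 < R by linarith)]
      have e4 : (∫ x : ℝ in (-R)..R, k x) = (∫ x : ℝ in (-R)..R, k (x + R * I))
          - I * (∫ y : ℝ in (0 : ℝ)..R, k (R + y * I))
          + I * (∫ y : ℝ in (0 : ℝ)..R, k (-R + y * I)) := by
        linear_combination key
      rw [e4]
      refine (norm_add_le _ _).trans ?_
      refine (add_le_add_left (norm_sub_le _ _) _).trans ?_
      simp only [norm_mul, norm_I, one_mul]
      rw [abs_of_pos (by linarith)] at e1 e2 e3
      refine (add_le_add (add_le_add e1 e2) e3).trans (le_of_eq ?_)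
      ring
    · intro z hz
      refine (hkc z ?_).continuousWithinAt
      have := hz.2
      simp [uIcc_of_le (show (0 : ℝ) ≤ R by linarith)] at this
      exact this.1
    · intro z hz
      refine hkd z ?_ (by simpa using hz.2)
      have := hz.1.2
      simp [min_eq_left (show (0 : ℝ) ≤ R by linarith)] at this
      exact this.1.le
  have hlim : Tendsto (fun R : ℝ => ∫ x : ℝ in (-R)..R, k x) atTop (𝓝 (∫ x : ℝ, k x)) :=
    intervalIntegral_tendsto_integral hkI tendsto_neg_atTop_atBot tendsto_id
  have hlim0 : Tendsto (fun R : ℝ => ∫ x : ℝ in (-R)..R, k x) atTop (𝓝 0) := by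
    refine squeeze_zero_norm' (a := fun R : ℝ => 32 * M / R) ?_ ?_
    · filter_upwards [eventually_ge_atTop 2] with R hR
      refine (hrect R (by linarith)).trans ?_
      rw [div_le_div_iff₀ (by nlinarith) (by linarith)]
      have : R ^ 2 ≤ 4 * (R - 1) ^ 2 := by nlinarith
      nlinarith
    · exact tendsto_const_nhds.div_atTop tendsto_id
  have h0 := tendsto_nhds_unique hlim hlim0
  simp_rw [hkreal] at h0
  rw [integral_sub hfi hint2, integral_mul_const, integral_complex_ofReal,
    integral_univ_inv_one_add_sq,
    sub_eq_zero] at h0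
  exact h0

/-- **Fatou's theorem** for the upper half-plane: a bounded holomorphic function has vertical
boundary limits almost everywhere. -/
lemma ae_exists_tendsto_of_bounded_of_differentiableOn {φ : ℂ → ℂ} {M : ℝ}
    (hφ : DifferentiableOn ℂ φ {z | 0 < z.im}) (hM : ∀ z : ℂ, 0 < z.im → ‖φ z‖ ≤ M) :
    ∀ᵐ x : ℝ, ∃ L : ℂ, Tendsto (fun ε : ℝ => φ (x + ε * I)) (𝓝[>] 0) (𝓝 L) := by
  have hM0 : 0 ≤ M := (norm_nonneg _).trans (hM I (by simp))
  have hU : IsOpen {z : ℂ | 0 < z.im} := isOpen_lt continuous_const continuous_im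
  have hconv : Convex ℝ {z : ℂ | 0 < z.im} := convex_halfSpace_im_gt 0
  obtain ⟨Φ, hΦ⟩ := hconv.exists_forall_hasDerivWithinAt hφ
  have hLip : LipschitzOnWith ⟨M, hM0⟩ Φ {z : ℂ | 0 < z.im} :=
    hconv.lipschitzOnWith_of_nnnorm_hasDerivWithin_le hΦ fun z hz => hM z hz
  obtain ⟨K, g, hg, hgeq⟩ : ∃ (K : NNReal) (g : ℂ → ℂ), LipschitzWith K g ∧
      EqOn Φ g {z : ℂ | 0 < z.im} := ⟨_, hLip.extend_finite_dimension⟩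
  have hgd : ∀ z : ℂ, 0 < z.im → HasDerivAt g (φ z) z := by
    intro z hz
    have h1 : HasDerivAt Φ (φ z) z := (hΦ z hz).hasDerivAt (hU.mem_nhds hz)
    exact h1.congr_of_eventuallyEq ((hgeq.symm).eventuallyEq_of_mem (hU.mem_nhds hz))
  have hgK : ∀ z w : ℂ, ‖g z - g w‖ ≤ K * ‖z - w‖ := fun z w => hg.norm_sub_le z w
  have hq : ∀ (s : ℝ) (y : ℂ), ‖y‖ ≤ K * |s| →
      ‖((2 * s * ((1 + s ^ 2) ^ 2)⁻¹ : ℝ) : ℂ) * y‖ ≤ 2 * K * (1 + s ^ 2)⁻¹ := by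
    intro s y hy
    rw [norm_mul, norm_real, norm_mul, norm_mul, norm_inv, Real.norm_eq_abs, Real.norm_eq_abs,
      Real.norm_eq_abs, abs_of_pos (show (0 : ℝ) < 2 by norm_num),
      abs_of_pos (show 0 < (1 + s ^ 2) ^ 2 by positivity)]
    calc 2 * |s| * ((1 + s ^ 2) ^ 2)⁻¹ * ‖y‖ ≤ 2 * |s| * ((1 + s ^ 2) ^ 2)⁻¹ * (K * |s|) := by
          gcongr
      _ = 2 * K * (s ^ 2 * ((1 + s ^ 2) ^ 2)⁻¹) := by rw [← sq_abs s]; ring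
      _ ≤ 2 * K * (1 + s ^ 2)⁻¹ := by
          gcongr
          rw [← div_eq_mul_inv, div_le_iff₀ (by positivity)]
          field_simp
          nlinarith [sq_nonneg s]
  have hqc : Continuous fun s : ℝ => ((2 * s * ((1 + s ^ 2) ^ 2)⁻¹ : ℝ) : ℂ) := by
    refine continuous_ofReal.comp ((continuous_const.mul continuous_id).mul
      (Continuous.inv₀ (by fun_prop) fun s => by positivity))
  have hbint : Integrable fun s : ℝ => 2 * (K : ℝ) * (1 + s ^ 2)⁻¹ :=
    integrable_inv_one_add_sq.const_mul _
  have hvb : ∀ (x ε δ s : ℝ), 0 < ε →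
      ‖(g (x + ε * s + δ * I) - g (x + δ * I)) / ε‖ ≤ K * |s| := by
    intro x ε δ s hε
    rw [norm_div, norm_real, Real.norm_eq_abs, abs_of_pos hε, div_le_iff₀ hε]
    refine (hgK _ _).trans (le_of_eq ?_)
    rw [show (x + ε * s + δ * I - (x + δ * I) : ℂ) = ((ε * s : ℝ) : ℂ) by push_cast; ring,
      norm_real, Real.norm_eq_abs, abs_mul, abs_of_pos hε]
    ring
  have hvc : ∀ (x ε δ : ℝ),
      Continuous fun s : ℝ => (g (x + ε * s + δ * I) - g (x + δ * I)) / ε := by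
    intro x ε δ
    exact ((hg.continuous.comp (by fun_prop)).sub continuous_const).div_const _
  have hparts : ∀ (x ε δ : ℝ), 0 < ε → 0 < δ → Real.pi * φ (x + ε * I + δ * I) =
      ∫ s : ℝ, ((2 * s * ((1 + s ^ 2) ^ 2)⁻¹ : ℝ) : ℂ) *
        ((g (x + ε * s + δ * I) - g (x + δ * I)) / ε) := by
    intro x ε δ hε hδ
    have him : ∀ z : ℂ, 0 ≤ z.im → 0 < (x + ε * z + δ * I : ℂ).im := by
      intro z hz
      simp
      nlinarith
    have hP := integral_inv_one_add_sq_mul_eq_pi_mul (f := fun z => φ (x + ε * z + δ * I)) (M := M)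
      (fun z hz => by
        refine DifferentiableAt.comp z
          ((hφ _ (him z hz)).differentiableAt (hU.mem_nhds (him z hz))) ?_
        fun_prop) (fun z hz => hM _ (him z hz))
    rw [← hP]
    have hv : ∀ s : ℝ, HasDerivAt (fun s : ℝ => (g (x + ε * s + δ * I) - g (x + δ * I)) / ε)
        (φ (x + ε * s + δ * I)) s := by
      intro s
      have h1 : HasDerivAt (fun z : ℂ => x + ε * z + δ * I) (ε : ℂ) (s : ℂ) := by
        simpa using! (((hasDerivAt_id (s : ℂ)).const_mul (ε : ℂ)).const_add (x : ℂ)).add_const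
          (δ * I)
      have h2 := ((((hgd _ (him s (by simp))).comp (s : ℂ) h1).sub_const
        (g (x + δ * I))).div_const (ε : ℂ)).comp_ofReal
      have hε' : (ε : ℂ) ≠ 0 := by exact_mod_cast hε.ne'
      rw [mul_div_cancel_right₀ _ hε'] at h2
      exact h2
    have hu : ∀ s : ℝ, HasDerivAt (fun s : ℝ => (((1 + s ^ 2)⁻¹ : ℝ) : ℂ))
        (-((2 * s * ((1 + s ^ 2) ^ 2)⁻¹ : ℝ) : ℂ)) s := by
      intro s
      have h1 : HasDerivAt (fun s : ℝ => (1 + s ^ 2)⁻¹) (-(2 * s * ((1 + s ^ 2) ^ 2)⁻¹)) s := by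
        have h2 : HasDerivAt (fun s : ℝ => 1 + s ^ 2) (2 * s) s := by
          simpa using (hasDerivAt_pow 2 s).const_add 1
        refine (h2.fun_inv (by positivity)).congr_deriv ?_
        rw [div_eq_mul_inv]; ring
      simpa using h1.ofReal_comp
    have hcontφ : Continuous fun s : ℝ => φ (x + ε * s + δ * I) := by
      refine continuous_iff_continuousAt.2 fun s => ?_
      have h1 : ContinuousAt φ (x + ε * s + δ * I) :=
        (hφ.differentiableAt (hU.mem_nhds (him s (by simp)))).continuousAt
      exact ContinuousAt.comp (f := fun s : ℝ => (x + ε * s + δ * I : ℂ)) h1 (by fun_prop)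
    have huv : ∀ s : ℝ, ‖(((1 + s ^ 2)⁻¹ : ℝ) : ℂ) *
        ((g (x + ε * s + δ * I) - g (x + δ * I)) / ε)‖ ≤ K * |s|⁻¹ := by
      intro s
      rcases eq_or_ne s 0 with rfl | hs
      · simp
      rw [norm_mul, norm_real, Real.norm_of_nonneg (by positivity)]
      have hs' : 0 < |s| := abs_pos.2 hs
      calc (1 + s ^ 2)⁻¹ * _ ≤ (1 + s ^ 2)⁻¹ * (K * |s|) := by gcongr; exact hvb x ε δ s hε
        _ = K * ((1 + |s| ^ 2)⁻¹ * |s|) := by rw [sq_abs]; ring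
        _ ≤ K * |s|⁻¹ := by
          gcongr
          rw [inv_mul_le_iff₀ (by positivity)]
          field_simp
          nlinarith
    have key := integral_mul_deriv_eq_deriv_mul
      (u := fun s : ℝ => (((1 + s ^ 2)⁻¹ : ℝ) : ℂ))
      (v := fun s : ℝ => (g (x + ε * s + δ * I) - g (x + δ * I)) / ε)
      (u' := fun s : ℝ => -((2 * s * ((1 + s ^ 2) ^ 2)⁻¹ : ℝ) : ℂ))
      (v' := fun s : ℝ => φ (x + ε * s + δ * I)) (a' := 0) (b' := 0)
      (fun s _ => hu s) (fun s _ => hv s) ?_ ?_ ?_ ?_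
    · rw [key]
      simp only [neg_mul, integral_neg, sub_zero, sub_neg_eq_add, zero_add]
    · refine (integrable_inv_one_add_sq.ofReal).mul_bdd (c := M) hcontφ.aestronglyMeasurable ?_
      exact Eventually.of_forall fun s => hM _ (him s (by simp))
    · refine hbint.mono' (hqc.neg.mul (hvc x ε δ)).aestronglyMeasurable ?_
      refine Eventually.of_forall fun s => ?_
      simp only [Pi.mul_apply, neg_mul, norm_neg]
      exact hq s _ (hvb x ε δ s hε)
    · refine squeeze_zero_norm huv ?_
      simpa using (tendsto_inv_atTop_zero.comp tendsto_abs_atBot_atTop).const_mul (K : ℝ)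
    · refine squeeze_zero_norm huv ?_
      simpa using (tendsto_inv_atTop_zero.comp tendsto_abs_atTop_atTop).const_mul (K : ℝ)
  have hbdry : ∀ (x ε : ℝ), 0 < ε → Real.pi * φ (x + ε * I) =
      ∫ s : ℝ, ((2 * s * ((1 + s ^ 2) ^ 2)⁻¹ : ℝ) : ℂ) * ((g (x + ε * s) - g x) / ε) := by
    intro x ε hε
    have h1 : Tendsto (fun δ : ℝ => ∫ s : ℝ, ((2 * s * ((1 + s ^ 2) ^ 2)⁻¹ : ℝ) : ℂ) *
        ((g (x + ε * s + δ * I) - g (x + δ * I)) / ε)) (𝓝[>] 0)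
        (𝓝 (∫ s : ℝ, ((2 * s * ((1 + s ^ 2) ^ 2)⁻¹ : ℝ) : ℂ) * ((g (x + ε * s) - g x) / ε))) := by
      refine tendsto_integral_filter_of_dominated_convergence
        (fun s : ℝ => 2 * (K : ℝ) * (1 + s ^ 2)⁻¹) ?_ ?_ hbint ?_
      · exact Eventually.of_forall fun δ => (hqc.mul (hvc x ε δ)).aestronglyMeasurable
      · exact Eventually.of_forall fun δ => Eventually.of_forall fun s =>
          hq s _ (hvb x ε δ s hε)
      · refine Eventually.of_forall fun s => Tendsto.mono_left ?_ nhdsWithin_le_nhds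
        have hgc := hg.continuous
        have : Continuous fun δ : ℝ => ((2 * s * ((1 + s ^ 2) ^ 2)⁻¹ : ℝ) : ℂ) *
            ((g (x + ε * s + δ * I) - g (x + δ * I)) / ε) := by fun_prop
        simpa using this.tendsto 0
    have h2 : Tendsto (fun δ : ℝ => Real.pi * φ (x + ε * I + δ * I)) (𝓝[>] 0)
        (𝓝 (Real.pi * φ (x + ε * I))) := by
      refine Tendsto.mono_left ?_ nhdsWithin_le_nhds
      have h3 : ContinuousAt φ (x + ε * I + (0 : ℝ) * I) := by
        refine (hφ.differentiableAt (hU.mem_nhds ?_)).continuousAt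
        simpa using hε
      have h4 : ContinuousAt (fun δ : ℝ => φ (x + ε * I + δ * I)) 0 :=
        ContinuousAt.comp (f := fun δ : ℝ => (x + ε * I + δ * I : ℂ)) h3 (by fun_prop)
      have := h4.tendsto.const_mul (Real.pi : ℂ)
      simpa using this
    refine tendsto_nhds_unique h2 (h1.congr' ?_)
    filter_upwards [self_mem_nhdsWithin] with δ hδ
    exact (hparts x ε δ hε hδ).symm
  have hA : LipschitzWith K fun x : ℝ => g x := by
    simpa using! hg.comp (isometry_ofReal.lipschitz)
  filter_upwards [hA.ae_differentiableAt_real] with x hx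
  have hd := hx.hasDerivAt
  set D := deriv (fun x : ℝ => g x) x
  refine ⟨(Real.pi : ℂ)⁻¹ * ∫ s : ℝ, ((2 * s * ((1 + s ^ 2) ^ 2)⁻¹ : ℝ) : ℂ) * (s * D), ?_⟩
  have h1 : Tendsto (fun ε : ℝ => (Real.pi : ℂ)⁻¹ * ∫ s : ℝ,
      ((2 * s * ((1 + s ^ 2) ^ 2)⁻¹ : ℝ) : ℂ) * ((g (x + ε * s) - g x) / ε)) (𝓝[>] 0)
      (𝓝 ((Real.pi : ℂ)⁻¹ * ∫ s : ℝ, ((2 * s * ((1 + s ^ 2) ^ 2)⁻¹ : ℝ) : ℂ) * (s * D))) := by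
    refine Tendsto.const_mul _ (tendsto_integral_filter_of_dominated_convergence
      (fun s : ℝ => 2 * (K : ℝ) * (1 + s ^ 2)⁻¹) ?_ ?_ hbint ?_)
    · refine Eventually.of_forall fun ε => (hqc.mul ?_).aestronglyMeasurable
      simpa using hvc x ε 0
    · filter_upwards [self_mem_nhdsWithin] with ε hε
      exact Eventually.of_forall fun s => hq s _ (by simpa using hvb x ε 0 s hε)
    · refine Eventually.of_forall fun s => Tendsto.const_mul _ ?_
      have h2 : HasDerivAt (fun ε : ℝ => g ((x + ε * s : ℝ) : ℂ)) (s • D) 0 := by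
        have h3 : HasDerivAt (fun ε : ℝ => x + ε * s) s 0 := by
          simpa using! ((hasDerivAt_id (0 : ℝ)).mul_const s).const_add x
        have hd' : HasDerivAt (fun x : ℝ => g x) D (x + 0 * s) := by simpa using hd
        exact HasDerivAt.scomp (0 : ℝ) hd' h3
      have h4 := h2.tendsto_slope_zero_right
      refine (h4.congr fun ε => ?_).trans (by simp)
      simp [div_eq_inv_mul]
  refine h1.congr' ?_
  filter_upwards [self_mem_nhdsWithin] with ε hε
  rw [← hbdry x ε hε, inv_mul_cancel_left₀]
  exact_mod_cast Real.pi_ne_zero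

/-- The Cauchy transform `z ↦ ∫ dμ(t) / (z - t)` of a measure on the real line. -/
noncomputable def cauchyTransform (μ : Measure ℝ) (z : ℂ) : ℂ := ∫ t : ℝ, 1 / (z - (t : ℂ)) ∂μ

lemma im_le_norm_sub_ofReal {z : ℂ} (hz : 0 < z.im) (t : ℝ) : z.im ≤ ‖z - t‖ := by
  have := abs_im_le_norm (z - t)
  simp only [sub_im, ofReal_im, sub_zero, abs_of_pos hz] at this
  exact this

lemma norm_one_div_sub_ofReal_le {z : ℂ} (hz : 0 < z.im) (t : ℝ) :
    ‖1 / (z - (t : ℂ))‖ ≤ 1 / z.im := by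
  rw [norm_div, norm_one]
  exact one_div_le_one_div_of_le hz (im_le_norm_sub_ofReal hz t)

lemma sub_ofReal_ne_zero {z : ℂ} (hz : 0 < z.im) (t : ℝ) : z - (t : ℂ) ≠ 0 :=
  norm_pos_iff.1 (hz.trans_le (im_le_norm_sub_ofReal hz t))

lemma continuous_one_div_sub_ofReal {z : ℂ} (hz : 0 < z.im) :
    Continuous fun t : ℝ => 1 / (z - (t : ℂ)) :=
  continuous_const.div (by fun_prop) fun t => sub_ofReal_ne_zero hz t

lemma integrable_one_div_sub_ofReal (μ : Measure ℝ) [IsFiniteMeasure μ] {z : ℂ} (hz : 0 < z.im) :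
    Integrable (fun t : ℝ => 1 / (z - (t : ℂ))) μ :=
  Integrable.of_bound (continuous_one_div_sub_ofReal hz).aestronglyMeasurable (1 / z.im)
    (Eventually.of_forall fun t => norm_one_div_sub_ofReal_le hz t)

lemma norm_cauchyTransform_le (μ : Measure ℝ) [IsFiniteMeasure μ] {z : ℂ} (hz : 0 < z.im) :
    ‖cauchyTransform μ z‖ ≤ 1 / z.im * μ.real univ :=
  norm_integral_le_of_norm_le_const (Eventually.of_forall fun t => norm_one_div_sub_ofReal_le hz t)

lemma differentiableAt_cauchyTransform (μ : Measure ℝ) [IsFiniteMeasure μ] {z : ℂ}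
    (hz : 0 < z.im) : DifferentiableAt ℂ (cauchyTransform μ) z := by
  have hball : ∀ w ∈ Metric.ball z (z.im / 2), z.im / 2 < w.im := by
    intro w hw
    have h1 : |(w - z).im| < z.im / 2 := (abs_im_le_norm _).trans_lt (mem_ball_iff_norm.1 hw)
    rw [sub_im, abs_lt] at h1
    linarith
  have hpos : 0 < z.im / 2 := half_pos hz
  refine (hasDerivAt_integral_of_dominated_loc_of_deriv_le
    (F := fun w (t : ℝ) => 1 / (w - (t : ℂ))) (F' := fun w (t : ℝ) => -1 / (w - (t : ℂ)) ^ 2)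
    (bound := fun _ => 1 / (z.im / 2) ^ 2) (Metric.ball_mem_nhds z hpos) ?_
    (integrable_one_div_sub_ofReal μ hz) ?_ ?_ (integrable_const _) ?_).2.differentiableAt
  · filter_upwards [Metric.ball_mem_nhds z hpos] with w hw
    exact (continuous_one_div_sub_ofReal (hpos.trans (hball w hw))).aestronglyMeasurable
  · refine Continuous.aestronglyMeasurable (continuous_const.div (by fun_prop) fun t => ?_)
    exact pow_ne_zero 2 (sub_ofReal_ne_zero hz t)
  · refine Eventually.of_forall fun t w hw => ?_
    have h1 := hball w hw
    rw [norm_div, norm_neg, norm_one, norm_pow]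
    gcongr
    exact h1.le.trans (im_le_norm_sub_ofReal (hpos.trans h1) t)
  · refine Eventually.of_forall fun t w hw => ?_
    have h1 := sub_ofReal_ne_zero (hpos.trans (hball w hw)) t
    simpa using! (((hasDerivAt_id w).sub_const (t : ℂ)).inv h1)

lemma neg_im_cauchyTransform (μ : Measure ℝ) [IsFiniteMeasure μ] (x : ℝ) {ε : ℝ} (hε : 0 < ε) :
    -(cauchyTransform μ (x + ε * I)).im = ∫ t : ℝ, ε / ((x - t) ^ 2 + ε ^ 2) ∂μ := by
  have hz : 0 < (x + ε * I : ℂ).im := by simpa using hε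
  have h1 := integral_im (𝕜 := ℂ) (integrable_one_div_sub_ofReal μ hz)
  change _ = (cauchyTransform μ (x + ε * I)).im at h1
  rw [← h1, ← integral_neg]
  refine integral_congr_ae (Eventually.of_forall fun t => ?_)
  simp [normSq_apply]
  rw [neg_div, neg_neg]
  congr 1
  ring

lemma continuous_div_sq_add_sq {ε : ℝ} (hε : 0 < ε) :
    Continuous fun p : ℝ × ℝ => ε / ((p.1 - p.2) ^ 2 + ε ^ 2) :=
  continuous_const.div (by fun_prop) fun p => by positivity

lemma ofReal_neg_im_cauchyTransform (μ : Measure ℝ) [IsFiniteMeasure μ] (x : ℝ) {ε : ℝ}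
    (hε : 0 < ε) : ENNReal.ofReal (-(cauchyTransform μ (x + ε * I)).im) =
      ∫⁻ t : ℝ, ENNReal.ofReal (ε / ((x - t) ^ 2 + ε ^ 2)) ∂μ := by
  rw [neg_im_cauchyTransform μ x hε, ofReal_integral_eq_lintegral_ofReal]
  · refine Integrable.of_bound ((continuous_div_sq_add_sq hε).comp
      (by fun_prop : Continuous fun t : ℝ => (x, t))).aestronglyMeasurable (1 / ε)
      (Eventually.of_forall fun t => ?_)
    rw [Real.norm_of_nonneg (by positivity), div_le_div_iff₀ (by positivity) hε]
    nlinarith [sq_nonneg (x - t)]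
  · exact Eventually.of_forall fun t => by positivity

lemma im_cauchyTransform_nonpos (μ : Measure ℝ) [IsFiniteMeasure μ] {z : ℂ} (hz : 0 < z.im) :
    (cauchyTransform μ z).im ≤ 0 := by
  have h1 := neg_im_cauchyTransform μ z.re hz
  rw [re_add_im] at h1
  have h2 : 0 ≤ ∫ t : ℝ, z.im / ((z.re - t) ^ 2 + z.im ^ 2) ∂μ :=
    integral_nonneg fun t => by positivity
  linarith

lemma lintegral_div_sq_add_sq (t : ℝ) {ε : ℝ} (hε : 0 < ε) :
    ∫⁻ x : ℝ, ENNReal.ofReal (ε / ((x - t) ^ 2 + ε ^ 2)) = ENNReal.ofReal Real.pi := by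
  lift ε to NNReal using hε.le
  have hε' : ε ≠ 0 := by exact_mod_cast hε.ne'
  have h2 : ∀ x : ℝ, ENNReal.ofReal (ε / ((x - t) ^ 2 + ε ^ 2)) =
      ENNReal.ofReal Real.pi * ProbabilityTheory.cauchyPDF t ε x := by
    intro x
    rw [ProbabilityTheory.cauchyPDF_def, ProbabilityTheory.cauchyPDFReal_def,
      ← ENNReal.ofReal_mul Real.pi_pos.le]
    congr 1
    have := Real.pi_ne_zero
    field_simp
  simp_rw [h2]
  rw [lintegral_const_mul _ (ProbabilityTheory.measurable_cauchyPDF _ _),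
    ProbabilityTheory.lintegral_cauchyPDF_eq_one t hε', mul_one]

/-- Poisson integrals of a singular measure have vanishing lower vertical limits almost
everywhere. -/
lemma ae_liminf_lintegral_div_sq_add_sq_eq_zero (μ : Measure ℝ) [IsFiniteMeasure μ]
    (hsing : μ ⟂ₘ (volume : Measure ℝ)) {ε : ℕ → ℝ} (hε : ∀ n, 0 < ε n)
    (hε0 : Tendsto ε atTop (𝓝 0)) :
    ∀ᵐ x : ℝ, liminf (fun n => ∫⁻ t : ℝ, ENNReal.ofReal (ε n / ((x - t) ^ 2 + ε n ^ 2)) ∂μ)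
      atTop = 0 := by
  have hmeas : ∀ (ν : Measure ℝ) [SFinite ν] (n : ℕ),
      Measurable fun x : ℝ => ∫⁻ t : ℝ, ENNReal.ofReal (ε n / ((x - t) ^ 2 + ε n ^ 2)) ∂ν :=
    fun ν _ n =>
      ((continuous_div_sq_add_sq (hε n)).measurable.ennreal_ofReal).lintegral_prod_right'
  refine (lintegral_eq_zero_iff (Measurable.liminf fun n => hmeas μ n)).1 ?_
  refine le_antisymm (ENNReal.le_of_forall_pos_le_add fun κ hκ _ => ?_) (zero_le)
  rw [zero_add]
  have hπ : ENNReal.ofReal Real.pi ≠ 0 := by simpa using Real.pi_pos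
  obtain ⟨S, hS, hμS, hvS⟩ := hsing
  obtain ⟨C, hCS, hC, hμC⟩ := hS.compl.exists_isCompact_sdiff_lt (μ := μ) (measure_ne_top _ _)
    (ε := (κ : ENNReal) / ENNReal.ofReal Real.pi)
    (ENNReal.div_ne_zero.2 ⟨by exact_mod_cast hκ.ne', ENNReal.ofReal_ne_top⟩)
  have hCc : μ Cᶜ ≤ (κ : ENNReal) / ENNReal.ofReal Real.pi := by
    have : Cᶜ ⊆ (Sᶜ \ C) ∪ S := by
      intro x hx
      by_cases h : x ∈ S
      · exact Or.inr h
      · exact Or.inl ⟨h, hx⟩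
    refine (measure_mono this).trans ((measure_union_le _ _).trans ?_)
    rw [hμS, add_zero]
    exact hμC.le
  have hvC : ∀ᵐ x : ℝ, x ∉ C := by
    rw [ae_iff]
    simpa using measure_mono_null hCS hvS
  have hoff : ∀ᵐ x : ℝ,
      liminf (fun n => ∫⁻ t : ℝ, ENNReal.ofReal (ε n / ((x - t) ^ 2 + ε n ^ 2)) ∂μ) atTop =
      liminf (fun n => ∫⁻ t in Cᶜ, ENNReal.ofReal (ε n / ((x - t) ^ 2 + ε n ^ 2)) ∂μ) atTop := by
    filter_upwards [hvC] with x hx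
    have hsplit : (fun n => ∫⁻ t : ℝ, ENNReal.ofReal (ε n / ((x - t) ^ 2 + ε n ^ 2)) ∂μ) =
        (fun n => ∫⁻ t in C, ENNReal.ofReal (ε n / ((x - t) ^ 2 + ε n ^ 2)) ∂μ) +
        (fun n => ∫⁻ t in Cᶜ, ENNReal.ofReal (ε n / ((x - t) ^ 2 + ε n ^ 2)) ∂μ) := by
      funext n
      exact (lintegral_add_compl _ hC.measurableSet).symm
    rw [hsplit]
    refine ENNReal.liminf_add_of_left_tendsto_zero ?_ _
    obtain ⟨d, hd, hdC⟩ := Metric.isOpen_iff.1 hC.isClosed.isOpen_compl x hx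
    have hbound : ∀ n, ∫⁻ t in C, ENNReal.ofReal (ε n / ((x - t) ^ 2 + ε n ^ 2)) ∂μ ≤
        ENNReal.ofReal (ε n / d ^ 2) * μ C := by
      intro n
      rw [← setLIntegral_const]
      refine setLIntegral_mono measurable_const fun t ht => ENNReal.ofReal_le_ofReal ?_
      have h1 : d ≤ |x - t| := by
        by_contra h
        refine hdC ?_ ht
        rw [Metric.mem_ball, dist_comm, Real.dist_eq]
        exact not_le.1 h
      have h2 : d ^ 2 ≤ (x - t) ^ 2 := by
        rw [← sq_abs (x - t)]
        gcongr
      have := hε n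
      gcongr
      nlinarith
    refine tendsto_of_tendsto_of_tendsto_of_le_of_le tendsto_const_nhds ?_
      (fun n => zero_le) hbound
    have h3 : Tendsto (fun n => ENNReal.ofReal (ε n / d ^ 2)) atTop (𝓝 0) := by
      simpa using ENNReal.tendsto_ofReal (hε0.div_const (d ^ 2))
    simpa using ENNReal.Tendsto.mul_const h3 (Or.inr (measure_ne_top μ C))
  rw [lintegral_congr_ae hoff]
  refine (lintegral_liminf_le fun n => hmeas _ n).trans ?_
  have hconst : ∀ n, ∫⁻ x : ℝ, ∫⁻ t in Cᶜ, ENNReal.ofReal (ε n / ((x - t) ^ 2 + ε n ^ 2)) ∂μ =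
      ENNReal.ofReal Real.pi * μ Cᶜ := by
    intro n
    rw [lintegral_lintegral_swap
      ((continuous_div_sq_add_sq (hε n)).measurable.ennreal_ofReal.aemeasurable)]
    simp_rw [lintegral_div_sq_add_sq _ (hε n)]
    rw [setLIntegral_const]
  simp_rw [hconst]
  rw [liminf_const]
  calc ENNReal.ofReal Real.pi * μ Cᶜ
      ≤ ENNReal.ofReal Real.pi * ((κ : ENNReal) / ENNReal.ofReal Real.pi) := by gcongr
    _ = κ := ENNReal.mul_div_cancel hπ ENNReal.ofReal_ne_top

/-- A continuous logarithm of a function with a nonzero limit converges. -/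
lemma exists_tendsto_of_tendsto_exp {h : ℝ → ℂ} (hh : ContinuousOn h (Ioi 0)) {c : ℂ}
    (hc : c ≠ 0) (hlim : Tendsto (fun ε => exp (h ε)) (𝓝[>] 0) (𝓝 c)) :
    ∃ L : ℂ, Tendsto h (𝓝[>] 0) (𝓝 L) := by
  have hlim1 : Tendsto (fun ε => exp (h ε) / c) (𝓝[>] 0) (𝓝 1) := by
    simpa [div_self hc] using hlim.div_const c
  have hev : ∀ᶠ ε in 𝓝[>] (0 : ℝ), exp (h ε) / c ∈ slitPlane :=
    hlim1 (isOpen_slitPlane.mem_nhds one_mem_slitPlane)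
  obtain ⟨r, hr, hrs⟩ := (mem_nhdsGT_iff_exists_Ioo_subset).1 hev
  rw [mem_Ioi] at hr
  set k : ℝ → ℂ := fun ε => h ε - log (exp (h ε) / c) with hk
  have hkc : ContinuousOn k (Ioo 0 r) := by
    have h1 : ContinuousOn h (Ioo 0 r) := hh.mono Ioo_subset_Ioi_self
    exact h1.sub ((h1.cexp.div_const c).clog hrs)
  have hkexp : ∀ ε, exp (k ε) = c := by
    intro ε
    rw [hk, exp_sub, exp_log (div_ne_zero (exp_ne_zero _) hc)]
    have := exp_ne_zero (h ε)
    field_simp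
  have hr2 : r / 2 ∈ Ioo 0 r := ⟨half_pos hr, half_lt_self hr⟩
  have hconst : ∀ ε ∈ Ioo 0 r, k ε = k (r / 2) := fun ε hε =>
    isCoveringMap_exp.isSeparatedMap.constOn_of_comp
      isCoveringMap_exp.isLocalHomeomorph.isLocallyInjective isPreconnected_Ioo hkc
      (fun a _ b _ => Subtype.ext ((hkexp a).trans (hkexp b).symm)) hε hr2
  refine ⟨k (r / 2) + log 1, ?_⟩
  refine ((hlim1.clog one_mem_slitPlane).const_add (k (r / 2))).congr' ?_
  filter_upwards [Ioo_mem_nhdsGT hr] with ε hε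
  rw [← hconst ε hε]
  simp [hk]

/-- The Cauchy transform of a finite singular measure has real vertical boundary values almost
everywhere. -/
lemma ae_exists_tendsto_cauchyTransform (μ : Measure ℝ) [IsFiniteMeasure μ]
    (hsing : μ ⟂ₘ (volume : Measure ℝ)) :
    ∀ᵐ x : ℝ, ∃ L : ℝ,
      Tendsto (fun ε : ℝ => cauchyTransform μ (x + ε * I)) (𝓝[>] 0) (𝓝 (L : ℂ)) := by
  have hnorm : ∀ z : ℂ, ‖exp (-I * cauchyTransform μ z)‖ = Real.exp (cauchyTransform μ z).im := by
    intro z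
    rw [norm_exp]
    simp
  have hfatou := ae_exists_tendsto_of_bounded_of_differentiableOn
    (φ := fun z => exp (-I * cauchyTransform μ z)) (M := 1)
    (fun z hz =>
      ((differentiableAt_cauchyTransform μ hz).const_mul _).cexp.differentiableWithinAt)
    (fun z hz => by
      rw [hnorm, Real.exp_le_one_iff]
      exact im_cauchyTransform_nonpos μ hz)
  obtain ⟨u, -, hu0, hu⟩ := exists_seq_strictAnti_tendsto (0 : ℝ)
  have hu' : Tendsto u atTop (𝓝[>] 0) :=
    tendsto_nhdsWithin_iff.2 ⟨hu, Eventually.of_forall hu0⟩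
  filter_upwards [hfatou, ae_liminf_lintegral_div_sq_add_sq_eq_zero μ hsing hu0 hu]
    with x ⟨c, hc⟩ hx
  simp_rw [← ofReal_neg_im_cauchyTransform μ x (hu0 _)] at hx
  have hc1 : 1 ≤ ‖c‖ := by
    refine le_of_forall_lt fun r hr => ?_
    by_contra! hcr
    obtain ⟨r', hr', hr1⟩ := exists_between hr
    rcases le_or_gt r' 0 with h0 | h0
    · exact absurd (hcr.trans_lt hr') (not_lt.2 (h0.trans (norm_nonneg c)))
    have h1 : ∀ᶠ n in atTop, ‖exp (-I * cauchyTransform μ (x + u n * I))‖ < r' :=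
      ((hc.comp hu').norm).eventually_lt_const (hcr.trans_lt hr')
    have h2 : ∃ᶠ n in atTop, ENNReal.ofReal (-(cauchyTransform μ (x + u n * I)).im) <
        ENNReal.ofReal (-Real.log r') := by
      refine frequently_lt_of_liminf_lt (by isBoundedDefault) ?_
      rw [hx]
      simpa using Real.log_neg h0 hr1
    obtain ⟨n, hn2, hn1⟩ := (h2.and_eventually h1).exists
    rw [hnorm, ← Real.lt_log_iff_exp_lt h0] at hn1
    have hn3 := (ENNReal.ofReal_lt_ofReal_iff (by linarith [Real.log_neg h0 hr1])).1 hn2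
    linarith
  have hc0 : c ≠ 0 := by
    rintro rfl
    simp at hc1
    linarith
  have hcont : ContinuousOn (fun ε : ℝ => -I * cauchyTransform μ (x + ε * I)) (Ioi 0) := by
    intro ε hε
    have hz : 0 < (x + ε * I : ℂ).im := by simpa using hε
    have h1 : ContinuousAt (fun ε : ℝ => cauchyTransform μ (x + ε * I)) ε :=
      ContinuousAt.comp (f := fun ε : ℝ => (x + ε * I : ℂ))
        (differentiableAt_cauchyTransform μ hz).continuousAt (by fun_prop)
    exact (continuousAt_const.mul h1).continuousWithinAt
  obtain ⟨L, hL⟩ := exists_tendsto_of_tendsto_exp hcont hc0 hc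
  have hL' : Tendsto (fun ε : ℝ => cauchyTransform μ (x + ε * I)) (𝓝[>] 0) (𝓝 (I * L)) := by
    refine (hL.const_mul I).congr fun ε => ?_
    rw [← mul_assoc]
    simp
  refine ⟨(I * L).re, ?_⟩
  have him : (I * L).im = 0 := by
    refine le_antisymm ?_ ?_
    · have h0 : Tendsto (fun ε : ℝ => (cauchyTransform μ (x + ε * I)).im) (𝓝[>] 0)
          (𝓝 (I * L).im) := (continuous_im.tendsto (I * L)).comp hL'
      refine le_of_tendsto h0 ?_
      filter_upwards [self_mem_nhdsWithin] with ε hε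
      exact im_cauchyTransform_nonpos μ (by simpa using hε)
    · have h1 : c = exp (-I * (I * L)) := tendsto_nhds_unique hc ((hL'.const_mul (-I)).cexp)
      have h2 : ‖c‖ = Real.exp (I * L).im := by
        rw [h1, norm_exp]
        simp
      rw [h2, Real.one_le_exp_iff] at hc1
      exact hc1
  have : ((I * L).re : ℂ) = I * L := Complex.ext (by simp) (by simpa using him.symm)
  rw [this]
  exact hL'

lemma tendsto_ofReal_inv_atTop : Tendsto (fun η : ℝ => ((η⁻¹ : ℝ) : ℂ)) atTop (𝓝 0) := by
  have h := (continuous_ofReal.tendsto 0).comp (tendsto_inv_atTop_zero (𝕜 := ℝ))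
  rw [ofReal_zero] at h
  exact h

lemma tendsto_mul_cauchyTransform_mul_I (μ : Measure ℝ) [IsFiniteMeasure μ] :
    Tendsto (fun η : ℝ => η * cauchyTransform μ (η * I)) atTop (𝓝 (-I * μ.real univ)) := by
  have h1 : Tendsto (fun η : ℝ => ∫ t : ℝ, η * (1 / (η * I - (t : ℂ))) ∂μ) atTop
      (𝓝 (∫ _ : ℝ, -I ∂μ)) := by
    refine tendsto_integral_filter_of_dominated_convergence (fun _ => 1) ?_ ?_
      (integrable_const _) ?_
    · filter_upwards [eventually_gt_atTop 0] with η hη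
      have hz : 0 < (η * I : ℂ).im := by simpa using hη
      exact (continuous_const.mul (continuous_one_div_sub_ofReal hz)).aestronglyMeasurable
    · filter_upwards [eventually_gt_atTop 0] with η hη
      have hz : 0 < (η * I : ℂ).im := by simpa using hη
      refine Eventually.of_forall fun t => ?_
      have h2 := norm_one_div_sub_ofReal_le hz t
      rw [norm_mul, norm_real, Real.norm_of_nonneg hη.le]
      simp only [mul_im, ofReal_re, I_im, mul_one, ofReal_im, I_re, mul_zero, add_zero] at h2
      calc η * _ ≤ η * (1 / η) := by gcongr
        _ = 1 := by field_simp
    · refine Eventually.of_forall fun t => ?_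
      have h2 : Tendsto (fun η : ℝ => (I - (t : ℂ) * ((η⁻¹ : ℝ) : ℂ))⁻¹) atTop (𝓝 (-I)) := by
        have h4 := ((tendsto_ofReal_inv_atTop.const_mul (t : ℂ)).const_sub I).inv₀ (by simp)
        simpa using h4
      refine h2.congr' ?_
      filter_upwards [eventually_gt_atTop 0] with η hη
      have hη' : (η : ℂ) ≠ 0 := by exact_mod_cast hη.ne'
      rw [one_div, ← div_eq_mul_inv, ← inv_div]
      congr 1
      push_cast
      field_simp
  refine (h1.congr fun η => integral_const_mul _ _).trans (by simp [mul_comm])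

lemma tendsto_cauchyTransform_mul_I (μ : Measure ℝ) [IsFiniteMeasure μ] :
    Tendsto (fun η : ℝ => cauchyTransform μ (η * I)) atTop (𝓝 0) := by
  have h := tendsto_ofReal_inv_atTop.mul (tendsto_mul_cauchyTransform_mul_I μ)
  rw [zero_mul] at h
  refine h.congr' ?_
  filter_upwards [eventually_gt_atTop 0] with η hη
  have hη' : (η : ℂ) ≠ 0 := by exact_mod_cast hη.ne'
  push_cast
  rw [inv_mul_cancel_left₀ hη']

/-- The asymptotics of the argument of `y - G` at infinity, where `G` is a Cauchy transform. -/
lemma tendsto_mul_arg_sub_cauchyTransform (μ : Measure ℝ) [IsFiniteMeasure μ] {y : ℝ}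
    (hy : 0 < y) :
    Tendsto (fun η : ℝ => η * arg (y - cauchyTransform μ (η * I))) atTop
      (𝓝 (μ.real univ / y)) := by
  have h1 := tendsto_mul_cauchyTransform_mul_I μ
  have h3 := tendsto_cauchyTransform_mul_I μ
  have hys : (y : ℂ) ∈ slitPlane := by simpa using hy
  have hd := hasDerivAt_log hys
  have h5 : Tendsto (fun η : ℝ => dslope log (y : ℂ) (y - cauchyTransform μ (η * I))) atTop
      (𝓝 (y : ℂ)⁻¹) := by
    have h6 := (continuousAt_dslope_same.2 hd.differentiableAt).tendsto
    rw [dslope_same, hd.deriv] at h6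
    exact h6.comp (by simpa using h3.const_sub (y : ℂ))
  have h7 : Tendsto (fun η : ℝ => (-(η * cauchyTransform μ (η * I) *
      dslope log (y : ℂ) (y - cauchyTransform μ (η * I)))).im) atTop
      (𝓝 (-(-I * μ.real univ * (y : ℂ)⁻¹)).im) :=
    (continuous_im.tendsto _).comp (h1.mul h5).neg
  have h8 : (-(-I * μ.real univ * (y : ℂ)⁻¹)).im = μ.real univ / y := by
    have h9 : -(-I * μ.real univ * (y : ℂ)⁻¹) = ((μ.real univ / y : ℝ) : ℂ) * I := by
      push_cast
      ring
    rw [h9, im_ofReal_mul, I_im, mul_one]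
  rw [h8] at h7
  refine h7.congr fun η => ?_
  have h9 := sub_smul_dslope log (y : ℂ) (y - cauchyTransform μ (η * I))
  have h10 : -(η * cauchyTransform μ (η * I) *
      dslope log (y : ℂ) (y - cauchyTransform μ (η * I))) =
      η * (log (y - cauchyTransform μ (η * I)) - log y) := by
    rw [← h9, smul_eq_mul]
    ring
  rw [h10, im_ofReal_mul, sub_im, log_im, log_im, arg_ofReal_of_nonneg hy.le, sub_zero]

/-- The boundary values of `arg` on the real axis, approached vertically from above. -/
noncomputable def argBoundary (r : ℝ) : ℝ :=
  if 0 < r then 0 else if r = 0 then Real.pi / 2 else Real.pi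

lemma tendsto_arg_add_mul_I (r : ℝ) :
    Tendsto (fun κ : ℝ => arg (r + κ * I)) (𝓝[>] 0) (𝓝 (argBoundary r)) := by
  have hc : Tendsto (fun κ : ℝ => (r + κ * I : ℂ)) (𝓝[>] 0) (𝓝 r) := by
    refine Tendsto.mono_left ?_ nhdsWithin_le_nhds
    have : Continuous fun κ : ℝ => (r + κ * I : ℂ) := by fun_prop
    simpa using this.tendsto 0
  rcases lt_trichotomy r 0 with hr | rfl | hr
  · rw [argBoundary, if_neg hr.not_gt, if_neg hr.ne]
    refine (tendsto_arg_nhdsWithin_im_nonneg_of_re_neg_of_im_zero (z := (r : ℂ))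
      (by simpa using hr) (by simp)).comp (tendsto_nhdsWithin_iff.2 ⟨hc, ?_⟩)
    filter_upwards [self_mem_nhdsWithin] with κ hκ
    simpa using (mem_Ioi.1 hκ).le
  · rw [argBoundary, if_neg (lt_irrefl _), if_pos rfl]
    refine tendsto_const_nhds.congr' ?_
    filter_upwards [self_mem_nhdsWithin] with κ hκ
    rw [ofReal_zero, zero_add, arg_real_mul _ hκ, arg_I]
  · rw [argBoundary, if_pos hr]
    have h := (continuousAt_arg (x := (r : ℂ)) (by simpa using hr)).tendsto.comp hc
    rwa [arg_ofReal_of_nonneg hr.le] at h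

lemma argBoundary_nonneg (r : ℝ) : 0 ≤ argBoundary r := by
  have := Real.pi_pos
  unfold argBoundary
  split_ifs <;> linarith

lemma argBoundary_le_pi (r : ℝ) : argBoundary r ≤ Real.pi := by
  have := Real.pi_pos
  unfold argBoundary
  split_ifs <;> linarith

lemma measurable_argBoundary : Measurable argBoundary :=
  Measurable.ite measurableSet_Ioi measurable_const
    (Measurable.ite (measurableSet_singleton 0) measurable_const measurable_const)

lemma ae_comp_mul_left {p : ℝ → Prop} (hp : ∀ᵐ x : ℝ, p x) {η : ℝ} (hη : 0 < η) :
    ∀ᵐ s : ℝ, p (η * s) := by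
  have h : Measure.QuasiMeasurePreserving (fun s : ℝ => η * s) volume volume := by
    refine ⟨measurable_const_mul η, ?_⟩
    rw [Real.map_volume_mul_left hη.ne']
    exact Measure.smul_absolutelyContinuous
  exact h.ae hp

/-- The Poisson representation of `arg (y + κ i - G)` in terms of the boundary values of `G`. -/
lemma integral_arg_add_mul_I_sub (μ : Measure ℝ) [IsFiniteMeasure μ] {g : ℝ → ℝ}
    (hg : ∀ᵐ x : ℝ, Tendsto (fun ε : ℝ => cauchyTransform μ (x + ε * I)) (𝓝[>] 0)
      (𝓝 (g x : ℂ))) (y : ℝ) {κ η : ℝ} (hκ : 0 < κ) (hη : 0 < η) :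
    ∫ s : ℝ, (1 + s ^ 2)⁻¹ * arg (y + κ * I - g (η * s)) =
      Real.pi * arg (y + κ * I - cauchyTransform μ (η * I)) := by
  have him : ∀ z : ℂ, 0 < z.im → κ ≤ (y + κ * I - cauchyTransform μ z).im := by
    intro z hz
    have := im_cauchyTransform_nonpos μ hz
    simp
    linarith
  have hslit : ∀ z : ℂ, κ ≤ z.im → z ∈ slitPlane := fun z hz => Or.inr (hκ.trans_le hz).ne'
  have hshift : ∀ {δ : ℝ}, 0 < δ → ∀ z : ℂ, 0 ≤ z.im → δ ≤ (η * z + δ * I : ℂ).im := by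
    intro δ hδ z hz
    simp
    positivity
  have happrox : ∀ δ : ℝ, 0 < δ →
      ∫ s : ℝ, (1 + s ^ 2)⁻¹ * arg (y + κ * I - cauchyTransform μ (η * s + δ * I)) =
      Real.pi * arg (y + κ * I - cauchyTransform μ (η * I + δ * I)) := by
    intro δ hδ
    set B : ℝ := ‖(y + κ * I : ℂ)‖ + 1 / δ * μ.real univ with hB
    have hcomp : IsCompact ({w : ℂ | κ ≤ w.im} ∩ Metric.closedBall 0 B) :=
      (isCompact_closedBall _ _).inter_left (isClosed_le continuous_const continuous_im)
    obtain ⟨M, hM⟩ := hcomp.exists_bound_of_continuousOn (f := log)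
      (fun w hw => (continuousAt_clog (hslit w hw.1)).continuousWithinAt)
    have hd : ∀ z : ℂ, 0 ≤ z.im → DifferentiableAt ℂ
        (fun z => log (y + κ * I - cauchyTransform μ (η * z + δ * I))) z := by
      intro z hz
      have hz' : 0 < (η * z + δ * I : ℂ).im := hδ.trans_le (hshift hδ z hz)
      refine DifferentiableAt.clog (DifferentiableAt.const_sub ?_ _) (hslit _ (him _ hz'))
      exact DifferentiableAt.comp (f := fun z : ℂ => η * z + δ * I) z
        (differentiableAt_cauchyTransform μ hz') (by fun_prop)
    have hb : ∀ z : ℂ, 0 ≤ z.im →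
        ‖log (y + κ * I - cauchyTransform μ (η * z + δ * I))‖ ≤ M := by
      intro z hz
      have hz1 := hshift hδ z hz
      have hz' : 0 < (η * z + δ * I : ℂ).im := hδ.trans_le hz1
      refine hM _ ⟨him _ hz', ?_⟩
      rw [mem_closedBall_zero_iff]
      refine (norm_sub_le _ _).trans ?_
      rw [hB]
      gcongr
      refine (norm_cauchyTransform_le μ hz').trans ?_
      gcongr
    have key := integral_inv_one_add_sq_mul_eq_pi_mul hd hb
    have hfi : Integrable fun s : ℝ => (((1 + s ^ 2)⁻¹ : ℝ) : ℂ) *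
        log (y + κ * I - cauchyTransform μ (η * s + δ * I)) := by
      refine (integrable_inv_one_add_sq.ofReal).mul_bdd (c := M) ?_ ?_
      · refine Continuous.aestronglyMeasurable (continuous_iff_continuousAt.2 fun s => ?_)
        exact (hd s (by simp)).continuousAt.comp continuous_ofReal.continuousAt
      · exact Eventually.of_forall fun s => hb s (by simp)
    have him1 := congrArg Complex.im key
    have him2 := integral_im (𝕜 := ℂ) hfi
    simp only [RCLike.im_eq_complex_im] at him2
    rw [← him2] at him1
    simpa only [im_ofReal_mul, log_im] using him1
  have hl : Tendsto (fun δ : ℝ => ∫ s : ℝ, (1 + s ^ 2)⁻¹ *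
      arg (y + κ * I - cauchyTransform μ (η * s + δ * I))) (𝓝[>] 0)
      (𝓝 (∫ s : ℝ, (1 + s ^ 2)⁻¹ * arg (y + κ * I - g (η * s)))) := by
    refine tendsto_integral_filter_of_dominated_convergence (fun s => (1 + s ^ 2)⁻¹ * Real.pi)
      ?_ ?_ (integrable_inv_one_add_sq.mul_const _) ?_
    · filter_upwards [self_mem_nhdsWithin] with δ hδ
      refine (continuous_iff_continuousAt.2 fun s => ?_).aestronglyMeasurable
      have hz' : 0 < (η * s + δ * I : ℂ).im := (mem_Ioi.1 hδ).trans_le (hshift hδ s (by simp))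
      refine ContinuousAt.mul (ContinuousAt.inv₀ (by fun_prop) (by positivity)) ?_
      refine ContinuousAt.comp (f := fun s : ℝ =>
        (y + κ * I - cauchyTransform μ (η * s + δ * I) : ℂ))
        (continuousAt_arg (hslit _ (him _ hz'))) (continuousAt_const.sub ?_)
      exact ContinuousAt.comp (f := fun s : ℝ => (η * s + δ * I : ℂ))
        (differentiableAt_cauchyTransform μ hz').continuousAt (by fun_prop)
    · refine Eventually.of_forall fun δ => Eventually.of_forall fun s => ?_
      rw [norm_mul, Real.norm_of_nonneg (by positivity)]
      gcongr
      exact abs_arg_le_pi _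
    · filter_upwards [ae_comp_mul_left hg hη] with s hs
      refine Tendsto.const_mul _ ((continuousAt_arg (hslit _ ?_)).tendsto.comp
        ((Tendsto.const_sub _ hs).congr fun δ => ?_))
      · simp
      · push_cast
        rfl
  have hr : Tendsto (fun δ : ℝ => Real.pi *
      arg (y + κ * I - cauchyTransform μ (η * I + δ * I))) (𝓝[>] 0)
      (𝓝 (Real.pi * arg (y + κ * I - cauchyTransform μ (η * I)))) := by
    have hz : 0 < (η * I : ℂ).im := by simpa using hη
    refine Tendsto.const_mul _ ((continuousAt_arg (hslit _ (him _ hz))).tendsto.comp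
      (Tendsto.const_sub _ ?_))
    refine (differentiableAt_cauchyTransform μ hz).continuousAt.tendsto.comp
      (Tendsto.mono_left ?_ nhdsWithin_le_nhds)
    have : Continuous fun δ : ℝ => (η * I + δ * I : ℂ) := by fun_prop
    simpa using this.tendsto 0
  refine tendsto_nhds_unique hl (hr.congr' ?_)
  filter_upwards [self_mem_nhdsWithin] with δ hδ
  exact (happrox δ hδ).symm

lemma integral_argBoundary_sub (μ : Measure ℝ) [IsFiniteMeasure μ] {g : ℝ → ℝ}
    (hgm : Measurable g)
    (hg : ∀ᵐ x : ℝ, Tendsto (fun ε : ℝ => cauchyTransform μ (x + ε * I)) (𝓝[>] 0)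
      (𝓝 (g x : ℂ))) {y η : ℝ} (hη : 0 < η)
    (hy : y - cauchyTransform μ (η * I) ∈ slitPlane) :
    ∫ s : ℝ, (1 + s ^ 2)⁻¹ * argBoundary (y - g (η * s)) =
      Real.pi * arg (y - cauchyTransform μ (η * I)) := by
  have hl : Tendsto (fun κ : ℝ => ∫ s : ℝ, (1 + s ^ 2)⁻¹ * arg (y + κ * I - g (η * s))) (𝓝[>] 0)
      (𝓝 (∫ s : ℝ, (1 + s ^ 2)⁻¹ * argBoundary (y - g (η * s)))) := by
    refine tendsto_integral_filter_of_dominated_convergence (fun s => (1 + s ^ 2)⁻¹ * Real.pi)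
      ?_ ?_ (integrable_inv_one_add_sq.mul_const _) ?_
    · refine Eventually.of_forall fun κ => Measurable.aestronglyMeasurable ?_
      exact Measurable.mul (by fun_prop) (measurable_arg.comp (by fun_prop))
    · refine Eventually.of_forall fun κ => Eventually.of_forall fun s => ?_
      rw [norm_mul, Real.norm_of_nonneg (by positivity)]
      gcongr
      exact abs_arg_le_pi _
    · refine Eventually.of_forall fun s => Tendsto.const_mul _ ?_
      refine (tendsto_arg_add_mul_I (y - g (η * s))).congr fun κ => ?_
      congr 1
      push_cast
      ring
  have hr : Tendsto (fun κ : ℝ => Real.pi * arg (y + κ * I - cauchyTransform μ (η * I))) (𝓝[>] 0)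
      (𝓝 (Real.pi * arg (y - cauchyTransform μ (η * I)))) := by
    refine Tendsto.const_mul _ ((continuousAt_arg hy).tendsto.comp
      (Tendsto.mono_left ?_ nhdsWithin_le_nhds))
    have : Continuous fun κ : ℝ => (y + κ * I - cauchyTransform μ (η * I) : ℂ) := by fun_prop
    simpa using this.tendsto 0
  refine tendsto_nhds_unique hl (hr.congr' ?_)
  filter_upwards [self_mem_nhdsWithin] with κ hκ
  exact (integral_arg_add_mul_I_sub μ hg y hκ hη).symm

lemma lintegral_argBoundary_sub (μ : Measure ℝ) [IsFiniteMeasure μ] {g : ℝ → ℝ}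
    (hgm : Measurable g)
    (hg : ∀ᵐ x : ℝ, Tendsto (fun ε : ℝ => cauchyTransform μ (x + ε * I)) (𝓝[>] 0)
      (𝓝 (g x : ℂ))) {y : ℝ} (hy : 0 < y) :
    ∫⁻ t : ℝ, ENNReal.ofReal (argBoundary (y - g t)) =
      ENNReal.ofReal (Real.pi * (μ.real univ / y)) := by
  set f : ℕ → ℝ → ℝ := fun n t => (1 + (t / (n + 1)) ^ 2)⁻¹ * argBoundary (y - g t) with hf
  have hfm : ∀ n, Measurable (f n) := fun n =>
    Measurable.mul (by fun_prop) (measurable_argBoundary.comp (by fun_prop))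
  have hfnn : ∀ n t, 0 ≤ f n t := fun n t => mul_nonneg (by positivity) (argBoundary_nonneg _)
  have hfint : ∀ n, Integrable (f n) := by
    intro n
    have hn : (n + 1 : ℝ) ≠ 0 := by positivity
    refine (integrable_inv_one_add_sq.comp_div hn).mul_bdd (c := Real.pi)
      (measurable_argBoundary.comp (by fun_prop)).aestronglyMeasurable
      (Eventually.of_forall fun t => ?_)
    rw [Real.norm_of_nonneg (argBoundary_nonneg _)]
    exact argBoundary_le_pi _
  have hlim : Tendsto (fun n => ∫⁻ t, ENNReal.ofReal (f n t)) atTop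
      (𝓝 (∫⁻ t : ℝ, ENNReal.ofReal (argBoundary (y - g t)))) := by
    refine lintegral_tendsto_of_tendsto_of_monotone
      (fun n => (hfm n).ennreal_ofReal.aemeasurable) ?_ ?_
    · refine Eventually.of_forall fun t m n hmn => ENNReal.ofReal_le_ofReal ?_
      have hmn' : (m : ℝ) ≤ n := by exact_mod_cast hmn
      have h1 : (t / (n + 1)) ^ 2 ≤ (t / (m + 1)) ^ 2 := by
        rw [div_pow, div_pow]
        gcongr
      have h2 := argBoundary_nonneg (y - g t)
      simp only [hf]
      gcongr
    · refine Eventually.of_forall fun t => ENNReal.tendsto_ofReal ?_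
      have h1 : Tendsto (fun n : ℕ => t / (n + 1 : ℝ)) atTop (𝓝 0) :=
        tendsto_const_nhds.div_atTop (tendsto_natCast_atTop_atTop.atTop_add tendsto_const_nhds)
      have h2 := (((h1.pow 2).const_add 1).inv₀ (by norm_num)).mul_const (argBoundary (y - g t))
      simpa using h2
  have hcast : Tendsto (fun n : ℕ => (n + 1 : ℝ)) atTop atTop :=
    tendsto_natCast_atTop_atTop.atTop_add tendsto_const_nhds
  have hslit : ∀ᶠ η : ℝ in atTop, y - cauchyTransform μ (η * I) ∈ slitPlane := by
    have h1 := (tendsto_cauchyTransform_mul_I μ).const_sub (y : ℂ)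
    rw [sub_zero] at h1
    exact h1 (isOpen_slitPlane.mem_nhds (by simpa using hy))
  have hlim' : Tendsto (fun n => ∫⁻ t, ENNReal.ofReal (f n t)) atTop
      (𝓝 (ENNReal.ofReal (Real.pi * (μ.real univ / y)))) := by
    refine (ENNReal.tendsto_ofReal (((tendsto_mul_arg_sub_cauchyTransform μ hy).comp
      hcast).const_mul Real.pi)).congr' ?_
    filter_upwards [hcast.eventually hslit] with n hn
    have hη : (0 : ℝ) < n + 1 := by positivity
    rw [← ofReal_integral_eq_lintegral_ofReal (hfint n) (Eventually.of_forall (hfnn n))]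
    congr 1
    have h1 := Measure.integral_comp_mul_left (f n) (n + 1 : ℝ)
    have h2 : ∀ s : ℝ, f n ((n + 1) * s) = (1 + s ^ 2)⁻¹ * argBoundary (y - g ((n + 1) * s)) := by
      intro s
      simp only [hf]
      rw [mul_div_cancel_left₀ _ hη.ne']
    have h3 := integral_argBoundary_sub μ hgm hg hη hn
    simp_rw [h2] at h1
    rw [h3, abs_of_pos (inv_pos.2 hη), smul_eq_mul, eq_inv_mul_iff_mul_eq₀ hη.ne'] at h1
    rw [← h1, Function.comp_apply]
    ring
  exact tendsto_nhds_unique hlim hlim'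

lemma volume_lt_boundary (μ : Measure ℝ) [IsFiniteMeasure μ] {g : ℝ → ℝ}
    (hgm : Measurable g)
    (hg : ∀ᵐ x : ℝ, Tendsto (fun ε : ℝ => cauchyTransform μ (x + ε * I)) (𝓝[>] 0)
      (𝓝 (g x : ℂ))) {y : ℝ} (hy : 0 < y) :
    volume {x | y < g x} = ENNReal.ofReal (μ.real univ / y) := by
  have hpi := Real.pi_pos
  have hpi0 : ENNReal.ofReal Real.pi ≠ 0 := by simpa using hpi
  have hle : ∀ y : ℝ, 0 < y → volume {x | y < g x} ≤ ENNReal.ofReal (μ.real univ / y) := by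
    intro y hy
    have h := lintegral_argBoundary_sub μ hgm hg hy
    rw [ENNReal.ofReal_mul hpi.le] at h
    rw [← ENNReal.mul_le_mul_iff_right hpi0 ENNReal.ofReal_ne_top, ← h,
      ← lintegral_indicator_const (measurableSet_lt measurable_const hgm)]
    refine lintegral_mono fun t => ?_
    by_cases ht : y < g t
    · rw [indicator_of_mem (by exact ht), argBoundary, if_neg (by linarith), if_neg (by linarith)]
    · rw [indicator_of_notMem (by exact ht)]
      exact zero_le
  have hge : ∀ y : ℝ, 0 < y → ENNReal.ofReal (μ.real univ / y) ≤ volume {x | y ≤ g x} := by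
    intro y hy
    have h := lintegral_argBoundary_sub μ hgm hg hy
    rw [ENNReal.ofReal_mul hpi.le] at h
    rw [← ENNReal.mul_le_mul_iff_right hpi0 ENNReal.ofReal_ne_top, ← h,
      ← lintegral_indicator_const (measurableSet_le measurable_const hgm)]
    refine lintegral_mono fun t => ?_
    by_cases ht : y ≤ g t
    · rw [indicator_of_mem (by exact ht)]
      exact ENNReal.ofReal_le_ofReal (argBoundary_le_pi _)
    · rw [argBoundary, if_pos (by linarith)]
      simp
  refine le_antisymm (hle y hy) ?_
  have hlim : Tendsto (fun y' : ℝ => ENNReal.ofReal (μ.real univ / y')) (𝓝[>] y)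
      (𝓝 (ENNReal.ofReal (μ.real univ / y))) :=
    ENNReal.tendsto_ofReal ((tendsto_const_nhds.div tendsto_id hy.ne').mono_left
      nhdsWithin_le_nhds)
  refine le_of_tendsto hlim ?_
  filter_upwards [self_mem_nhdsWithin] with y' hy'
  exact (hge y' (hy.trans hy')).trans (measure_mono fun x (hx : y' ≤ g x) =>
    show y < g x from lt_of_lt_of_le hy' hx)

/-- The vertical boundary values of the Cauchy transform are a.e. given by a measurable function. -/
lemma exists_measurable_ae_tendsto_cauchyTransform (μ : Measure ℝ) [IsFiniteMeasure μ]
    (hsing : μ ⟂ₘ (volume : Measure ℝ)) :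
    ∃ g : ℝ → ℝ, Measurable g ∧
      ∀ᵐ x : ℝ, Tendsto (fun ε : ℝ => cauchyTransform μ (x + ε * I)) (𝓝[>] 0) (𝓝 (g x : ℂ)) := by
  have hex := ae_exists_tendsto_cauchyTransform μ hsing
  obtain ⟨u, -, hu0, hu⟩ := exists_seq_strictAnti_tendsto (0 : ℝ)
  have hu' : Tendsto u atTop (𝓝[>] 0) :=
    tendsto_nhdsWithin_iff.2 ⟨hu, Eventually.of_forall hu0⟩
  have hre : ∀ {x L : ℝ}, Tendsto (fun ε : ℝ => cauchyTransform μ (x + ε * I)) (𝓝[>] 0)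
      (𝓝 (L : ℂ)) → Tendsto (fun n => (cauchyTransform μ (x + u n * I)).re) atTop (𝓝 L) :=
    fun {x L} h => (continuous_re.tendsto (L : ℂ)).comp (h.comp hu')
  have hm : ∀ n, Measurable fun x : ℝ => (cauchyTransform μ (x + u n * I)).re := by
    intro n
    refine (continuous_re.comp (continuous_iff_continuousAt.2 fun x => ?_)).measurable
    have hz : 0 < (x + u n * I : ℂ).im := by simpa using hu0 n
    exact ContinuousAt.comp (f := fun x : ℝ => (x + u n * I : ℂ))
      (differentiableAt_cauchyTransform μ hz).continuousAt (by fun_prop)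
  obtain ⟨g, hgm, hg⟩ := measurable_limit_of_tendsto_metrizable_ae
    (fun n => (hm n).aemeasurable) (hex.mono fun x ⟨L, hL⟩ => ⟨L, hre hL⟩)
  refine ⟨g, hgm, ?_⟩
  filter_upwards [hg, hex] with x hx ⟨L, hL⟩
  rwa [tendsto_nhds_unique hx (hre hL)]

/-- The Boole identity for the upper level sets of the boundary values of a Cauchy transform. -/
lemma volume_exists_tendsto_cauchyTransform_lt (μ : Measure ℝ) [IsFiniteMeasure μ]
    (hsing : μ ⟂ₘ (volume : Measure ℝ)) {y : ℝ} (hy : 0 < y) :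
    volume {x : ℝ | ∃ L : ℝ, Tendsto (fun ε : ℝ => cauchyTransform μ (x + ε * I)) (𝓝[>] 0)
      (𝓝 (L : ℂ)) ∧ y < L} = μ univ / ENNReal.ofReal y := by
  obtain ⟨g, hgm, hg⟩ := exists_measurable_ae_tendsto_cauchyTransform μ hsing
  have hset : {x : ℝ | ∃ L : ℝ, Tendsto (fun ε : ℝ => cauchyTransform μ (x + ε * I)) (𝓝[>] 0)
      (𝓝 (L : ℂ)) ∧ y < L} =ᵐ[volume] {x | y < g x} := by
    filter_upwards [hg] with x hx
    refine propext ⟨fun ⟨L, hL, hyL⟩ => ?_, fun h => ⟨g x, hx, h⟩⟩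
    have : L = g x := by exact_mod_cast tendsto_nhds_unique hL hx
    rw [this] at hyL
    exact hyL
  rw [measure_congr hset, volume_lt_boundary μ hgm hg hy, ENNReal.ofReal_div_of_pos hy,
    ofReal_measureReal]

open ComplexConjugate in
lemma cauchyTransform_map_neg (μ : Measure ℝ) (z : ℂ) :
    cauchyTransform (μ.map Neg.neg) z = -conj (cauchyTransform μ (-conj z)) := by
  have h := integral_map_equiv (μ := μ) (MeasurableEquiv.neg ℝ) fun t : ℝ => 1 / (z - (t : ℂ))
  have h' : cauchyTransform (μ.map Neg.neg) z = ∫ t : ℝ, 1 / (z - ((-t : ℝ) : ℂ)) ∂μ := h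
  rw [h', cauchyTransform, ← integral_conj, ← integral_neg]
  congr 1 with t
  have : z - ((-t : ℝ) : ℂ) = -conj (-conj z - (t : ℂ)) := by
    simp [add_comm]
  rw [this, div_neg]
  simp only [map_div₀, map_one]

lemma mutuallySingular_map_neg {μ : Measure ℝ} (hsing : μ ⟂ₘ (volume : Measure ℝ)) :
    μ.map Neg.neg ⟂ₘ (volume : Measure ℝ) := by
  obtain ⟨s, hs, h1, h2⟩ := hsing
  refine ⟨-s, hs.neg, ?_, ?_⟩
  · rw [Measure.map_apply measurable_neg hs.neg]
    simpa using h1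
  · rw [show (-s)ᶜ = -sᶜ from rfl, Measure.measure_neg]
    exact h2

open ComplexConjugate in
/-- The Boole identity for the lower level sets of the boundary values of a Cauchy transform. -/
lemma volume_exists_tendsto_cauchyTransform_lt_neg (μ : Measure ℝ) [IsFiniteMeasure μ]
    (hsing : μ ⟂ₘ (volume : Measure ℝ)) {y : ℝ} (hy : 0 < y) :
    volume {x : ℝ | ∃ L : ℝ, Tendsto (fun ε : ℝ => cauchyTransform μ (x + ε * I)) (𝓝[>] 0)
      (𝓝 (L : ℂ)) ∧ L < -y} = μ univ / ENNReal.ofReal y := by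
  have h := volume_exists_tendsto_cauchyTransform_lt (μ.map Neg.neg)
    (mutuallySingular_map_neg hsing) hy
  rw [Measure.map_apply measurable_neg MeasurableSet.univ, preimage_univ] at h
  rw [← h, ← Measure.measure_neg]
  congr 1 with x
  have hconj : ∀ ε : ℝ, cauchyTransform (μ.map Neg.neg) (x + ε * I) =
      -conj (cauchyTransform μ (((-x : ℝ) : ℂ) + ε * I)) := by
    intro ε
    rw [cauchyTransform_map_neg]
    congr 3
    simp
    ring
  simp_rw [Set.mem_neg, mem_ofPred_eq, hconj]
  refine ⟨fun ⟨L, hL, hyL⟩ => ⟨-L, ?_, by linarith⟩, fun ⟨L, hL, hyL⟩ => ⟨-L, ?_, by linarith⟩⟩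
  · have h1 := ((continuous_conj.tendsto _).comp hL).neg
    simpa using h1
  · have h1 := (continuous_conj.tendsto _).comp hL.neg
    simpa [Function.comp_def] using h1

/-- (Boole–Hruščev–Vinogradov) Let `μ` be a finite positive measure on `ℝ`, singular with
respect to Lebesgue measure, and `G_μ(z) = ∫ dμ(t)/(z−t)` its Cauchy transform. Then the
boundary values of `G_μ` exist and are real almost everywhere, and for every `y > 0` the
Lebesgue measure of each of the sets `{G_μ > y}` and `{G_μ < −y}` equals `μ(ℝ)/y`. -/
theorem boole_hruscev_vinogradov (μ : Measure ℝ) [IsFiniteMeasure μ]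
    (hsing : μ ⟂ₘ (volume : Measure ℝ))
    (G : ℂ → ℂ)
    (hG : ∀ z : ℂ, 0 < z.im → G z = ∫ t, 1 / (z - (t : ℂ)) ∂μ) :
    (∀ᵐ (x : ℝ) ∂(volume : Measure ℝ), ∃ L : ℝ,
        Tendsto (fun ε : ℝ => G ((x : ℂ) + (ε : ℂ) * Complex.I)) (𝓝[>] 0) (𝓝 (L : ℂ))) ∧
    ∀ y : ℝ, 0 < y →
      volume {x : ℝ | ∃ L : ℝ,
          Tendsto (fun ε : ℝ => G ((x : ℂ) + (ε : ℂ) * Complex.I)) (𝓝[>] 0) (𝓝 (L : ℂ)) ∧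
          y < L}
        = μ Set.univ / ENNReal.ofReal y ∧
      volume {x : ℝ | ∃ L : ℝ,
          Tendsto (fun ε : ℝ => G ((x : ℂ) + (ε : ℂ) * Complex.I)) (𝓝[>] 0) (𝓝 (L : ℂ)) ∧
          L < -y}
        = μ Set.univ / ENNReal.ofReal y := by
  have hcongr : ∀ (x : ℝ) (L : ℂ),
      Tendsto (fun ε : ℝ => G ((x : ℂ) + (ε : ℂ) * Complex.I)) (𝓝[>] 0) (𝓝 L) ↔
      Tendsto (fun ε : ℝ => cauchyTransform μ (x + ε * I)) (𝓝[>] 0) (𝓝 L) := by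
    intro x L
    refine tendsto_congr' ?_
    filter_upwards [self_mem_nhdsWithin] with ε hε
    exact hG _ (by simpa using hε)
  simp_rw [hcongr]
  exact ⟨ae_exists_tendsto_cauchyTransform μ hsing, fun y hy =>
    ⟨volume_exists_tendsto_cauchyTransform_lt μ hsing hy,
      volume_exists_tendsto_cauchyTransform_lt_neg μ hsing hy⟩⟩
end
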